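/- Let N ≥ 2 and k ≥ 1. For each i = 1,…,k let V_i be a real vector space of finite dimension d_i with an inner product norm, let (A_1^{(i)},…,A_N^{(i)}) ∈ GL(V_i)^N be irreducible and let β_i > 0; define the submultiplicative potential Φ(𝚒) := ∏_{i=1}^k ‖A_𝚒^{(i)}‖^{β_i} for words 𝚒 ∈ Σ_N^*. For each i let ℓ_i be the smallest nonzero dimension of a subspace of V_i whose orbit under (A_1^{(i)},…,A_N^{(i)}) is finite. Then: (1) t_i := d_i/ℓ_i is an integer for each i; (2) setting p := (max_i t_i)^{-1}·∏_{i=1}^k t_i, there exist finite sets 𝒲_1,…,𝒲_p ⊂ ∏_{i=1}^k Gr_{ℓ_i}(V_i), each invariant in the sense that (A_𝚒^{(i)} W_i)_{i=1}^k ∈ 𝒲_j whenever (W_i)_{i=1}^k ∈ 𝒲_j and 𝚒 ∈ Σ_N^*, such that: (3) for each j = 1,…,p the potential Φ^j(𝚒) := max_{(W_i)∈𝒲_j} ∏_{i=1}^k ‖A_𝚒^{(i)}|_{W_i}‖^{β_i} is submultiplicative and quasimultiplicative and has a unique equilibrium state, which satisfies a Gibbs inequality with respect to Φ^j; (4) there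 exists τ > 0 with τ·Φ(𝚒) ≤ max_{1≤j≤p} Φ^j(𝚒) ≤ Φ(𝚒) for every word 𝚒; (5) every ergodic equilibrium state of Φ is an equilibrium state of at least one of the Φ^j. In particular Φ has at most p ergodic equilibrium states and every equilibrium state of Φ is fully supported. -/

import Mathlib

open MeasureTheory Filter

/-- Words over the alphabet `{1,…,N}`, modelled as `Fin N`. -/
abbrev Word (N : ℕ) := List (Fin N)

/-- The shift map on `Σ_N = {1,…,N}^ℕ`. -/
def shift (N : ℕ) : (ℕ → Fin N) → (ℕ → Fin N) := fun x n => x (n + 1)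

/-- The cylinder set `[𝚒]` of a word `𝚒`. -/
def cyl {N : ℕ} (l : Word N) : Set (ℕ → Fin N) :=
  {x | ∀ m : Fin l.length, x m = l.get m}

/-- `μ` is a shift-invariant Borel probability measure on `Σ_N`. -/
def IsInvProb {N : ℕ} (μ : Measure (ℕ → Fin N)) : Prop :=
  IsProbabilityMeasure μ ∧ μ.map (shift N) = μ

/-- `Φ` is submultiplicative: `Φ(𝚒𝚓) ≤ Φ(𝚒)Φ(𝚓)`. -/
def Submult {N : ℕ} (Φ : Word N → ℝ) : Prop :=
  ∀ l m : Word N, Φ (l ++ m) ≤ Φ l * Φ m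

/-- The pressure `P(Φ) = lim_n (1/n) log Σ_{|𝚒|=n} Φ(𝚒)` of a submultiplicative potential
(the limit exists by subadditivity, so it coincides with this `liminf`). -/
noncomputable def pressure {N : ℕ} (Φ : Word N → ℝ) : ℝ :=
  liminf (fun n : ℕ => (1 / n : ℝ) *
    Real.log (∑ f : Fin n → Fin N, Φ (List.ofFn f))) atTop

/-- A measure is fully supported if every nonempty open set has positive measure. -/
def FullySupported {N : ℕ} (μ : Measure (ℕ → Fin N)) : Prop :=
  ∀ U : Set (ℕ → Fin N), IsOpen U → U.Nonempty → 0 < μ U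

/-- `μ` satisfies a Gibbs inequality with respect to `Φ` with constant `C`:
`C⁻¹ Φ(𝚒) ≤ μ([𝚒]) e^{|𝚒| P(Φ)} ≤ C Φ(𝚒)` for all words `𝚒`. -/
def GibbsWith {N : ℕ} (Φ : Word N → ℝ) (μ : Measure (ℕ → Fin N)) (C : ℝ) : Prop :=
  0 < C ∧ ∀ l : Word N,
    C⁻¹ * Φ l ≤ (μ (cyl l)).toReal * Real.exp (l.length * pressure Φ) ∧
    (μ (cyl l)).toReal * Real.exp (l.length * pressure Φ) ≤ C * Φ l

/-- The asymptotic average `Λ(Φ,μ) = lim_n (1/n) Σ_{|𝚒|=n} μ([𝚒]) log Φ(𝚒)`. -/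
noncomputable def lambdaAvg {N : ℕ} (Φ : Word N → ℝ) (μ : Measure (ℕ → Fin N)) : ℝ :=
  liminf (fun n : ℕ => (1 / n : ℝ) *
    ∑ f : Fin n → Fin N, (μ (cyl (List.ofFn f))).toReal * Real.log (Φ (List.ofFn f))) atTop

/-- The Kolmogorov–Sinai entropy of a shift-invariant measure on the full shift,
computed via the generating partition into cylinders:
`h(μ) = lim_n (1/n) Σ_{|𝚒|=n} -μ([𝚒]) log μ([𝚒])` (the limit exists by subadditivity). -/
noncomputable def mEntropy {N : ℕ} (μ : Measure (ℕ → Fin N)) : ℝ :=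
  liminf (fun n : ℕ => (1 / n : ℝ) *
    ∑ f : Fin n → Fin N, Real.negMulLog ((μ (cyl (List.ofFn f))).toReal)) atTop

/-- `μ` is an equilibrium state of `Φ`: a shift-invariant Borel probability measure with
`h(μ) + Λ(Φ,μ) = P(Φ)`; by the subadditive variational principle
`P(Φ) = sup_ν [h(ν) + Λ(Φ,ν)]`, so such measures attain the supremum. -/
def IsEqState {N : ℕ} (Φ : Word N → ℝ) (μ : Measure (ℕ → Fin N)) : Prop :=
  IsInvProb μ ∧ mEntropy μ + lambdaAvg Φ μ = pressure Φ

/-- `Φ` is quasimultiplicative: there are `δ > 0` and a finite set `F` of words so that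
`max_{𝚓 ∈ F} Φ(𝚒𝚓𝚔) ≥ δ Φ(𝚒)Φ(𝚔)` for all words `𝚒`, `𝚔`. -/
def Quasimult {N : ℕ} (Φ : Word N → ℝ) : Prop :=
  ∃ δ : ℝ, 0 < δ ∧ ∃ F : Finset (Word N),
    ∀ l m : Word N, ∃ j ∈ F, δ * (Φ l * Φ m) ≤ Φ (l ++ j ++ m)


/-- The word product `A_𝚒 := A_{𝚒_n} ⋯ A_{𝚒_1}` for a word `𝚒 = (𝚒_1, …, 𝚒_n)`. -/
def wordProd {M : Type*} [Monoid M] {N : ℕ} (A : Fin N → M) (l : Word N) : M :=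
  (l.reverse.map A).prod

/-- A tuple of linear endomorphisms is irreducible if no proper nonzero subspace is
invariant under every member of the tuple. -/
def IrreducibleTuple {R V : Type*} [CommRing R] [AddCommGroup V] [Module R V]
    {N : ℕ} (A : Fin N → (V →ₗ[R] V)) : Prop :=
  ∀ U : Submodule R V, (∀ j, U.map (A j) = U) → U = ⊥ ∨ U = ⊤

/-- A tuple of linear endomorphisms is strongly irreducible if no finite (nonempty)
collection of proper nonzero subspaces is invariant under every member of the tuple. -/
def StronglyIrreducibleTuple {R V : Type*} [CommRing R] [AddCommGroup V] [Module R V]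
    {N : ℕ} (A : Fin N → (V →ₗ[R] V)) : Prop :=
  ∀ S : Set (Submodule R V), S.Finite → S.Nonempty → (∀ U ∈ S, U ≠ ⊥ ∧ U ≠ ⊤) →
    ¬(∀ j, ∀ U ∈ S, U.map (A j) ∈ S)

/-- The operator norm of the restriction `f|_U` of a continuous linear map to a subspace. -/
noncomputable def restrNorm {V : Type*} [NormedAddCommGroup V] [InnerProductSpace ℝ V]
    (f : V →L[ℝ] V) (U : Submodule ℝ V) : ℝ :=
  ‖f.comp U.subtypeL‖

open Topology

/-- The sum of `g` over all words of length `n`. -/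
noncomputable def wordSum {N : ℕ} (n : ℕ) (g : Word N → ℝ) : ℝ :=
  ∑ f : Fin n → Fin N, g (List.ofFn f)

section WordSum
variable {N : ℕ}

lemma wordSum_add (n m : ℕ) (g : Word N → ℝ) :
    wordSum (n + m) g = wordSum n fun a => wordSum m fun b => g (a ++ b) := by
  unfold wordSum
  rw [← (Fin.appendEquiv n m).sum_comp, Fintype.sum_prod_type]
  simp [Fin.appendEquiv, List.ofFn_fin_append]

lemma wordSum_congr {n : ℕ} {g h : Word N → ℝ} (H : ∀ l : Word N, l.length = n → g l = h l) :
    wordSum n g = wordSum n h :=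
  Finset.sum_congr rfl fun f _ => H _ (by simp)

lemma wordSum_le {n : ℕ} {g h : Word N → ℝ} (H : ∀ l : Word N, l.length = n → g l ≤ h l) :
    wordSum n g ≤ wordSum n h :=
  Finset.sum_le_sum fun f _ => H _ (by simp)

lemma wordSum_nonneg {n : ℕ} {g : Word N → ℝ} (H : ∀ l : Word N, l.length = n → 0 ≤ g l) :
    0 ≤ wordSum n g :=
  Finset.sum_nonneg fun f _ => H _ (by simp)

lemma wordSum_pos [NeZero N] {n : ℕ} {g : Word N → ℝ} (H : ∀ l : Word N, l.length = n → 0 < g l) :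
    0 < wordSum n g :=
  Finset.sum_pos (fun f _ => H _ (by simp)) Finset.univ_nonempty

lemma wordSum_mul_left (n : ℕ) (c : ℝ) (g : Word N → ℝ) :
    wordSum n (fun l => c * g l) = c * wordSum n g := by
  simp [wordSum, Finset.mul_sum]

lemma wordSum_mul_right (n : ℕ) (c : ℝ) (g : Word N → ℝ) :
    wordSum n (fun l => g l * c) = wordSum n g * c := by
  simp [wordSum, Finset.sum_mul]

lemma wordSum_div (n : ℕ) (c : ℝ) (g : Word N → ℝ) :
    wordSum n (fun l => g l / c) = wordSum n g / c := by
  simp [wordSum, Finset.sum_div]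

lemma wordSum_add_fun (n : ℕ) (g h : Word N → ℝ) :
    wordSum n (fun l => g l + h l) = wordSum n g + wordSum n h := by
  simp [wordSum, Finset.sum_add_distrib]

lemma wordSum_sub_fun (n : ℕ) (g h : Word N → ℝ) :
    wordSum n (fun l => g l - h l) = wordSum n g - wordSum n h := by
  simp [wordSum, Finset.sum_sub_distrib]

lemma wordSum_comm (n m : ℕ) (g : Word N → Word N → ℝ) :
    wordSum n (fun a => wordSum m fun b => g a b) =
      wordSum m fun b => wordSum n fun a => g a b := by
  unfold wordSum
  exact Finset.sum_comm

lemma wordSum_finset_sum {ι : Type*} (s : Finset ι) (n : ℕ) (g : ι → Word N → ℝ) :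
    wordSum n (fun a => ∑ i ∈ s, g i a) = ∑ i ∈ s, wordSum n (g i) := by
  unfold wordSum
  exact Finset.sum_comm

lemma wordSum_ite_eq (l : Word N) (g : Word N → ℝ) :
    wordSum l.length (fun a => if a = l then g a else 0) = g l := by
  unfold wordSum
  rw [Finset.sum_eq_single (fun i => l.get i)]
  · simp
  · intro f _ hf
    refine if_neg fun h => ?_
    apply hf
    apply List.ofFn_injective
    rw [h, List.ofFn_get]
  · simp

lemma le_wordSum {l : Word N} {g : Word N → ℝ} (H : ∀ a : Word N, a.length = l.length → 0 ≤ g a) :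
    g l ≤ wordSum l.length g := by
  rw [← wordSum_ite_eq l g]
  apply wordSum_le
  intro a ha
  split_ifs
  · exact le_rfl
  · exact H a ha

end WordSum

/-- The prefix of length `n` of a sequence. -/
def seqPrefix {N : ℕ} (n : ℕ) (x : ℕ → Fin N) : Word N := List.ofFn fun i : Fin n => x i

section Prefix
variable {N : ℕ}

@[simp] lemma length_seqPrefix (n : ℕ) (x : ℕ → Fin N) : (seqPrefix n x).length = n := by
  simp [seqPrefix]

lemma iterate_shift_apply (n m : ℕ) (x : ℕ → Fin N) : (shift N)^[n] x m = x (m + n) := by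
  induction n generalizing x with
  | zero => rfl
  | succ n ih =>
    rw [Function.iterate_succ_apply, ih]
    simp only [shift]
    congr 1

lemma seqPrefix_add (n m : ℕ) (x : ℕ → Fin N) :
    seqPrefix (n + m) x = seqPrefix n x ++ seqPrefix m ((shift N)^[n] x) := by
  unfold seqPrefix
  rw [← List.ofFn_fin_append]
  congr 1
  ext i
  refine Fin.addCases (fun i => ?_) (fun i => ?_) i
  · simp
  · simp [iterate_shift_apply, add_comm]

lemma mem_cyl_iff {l : Word N} {x : ℕ → Fin N} : x ∈ cyl l ↔ seqPrefix l.length x = l := by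
  unfold cyl seqPrefix
  rw [Set.mem_ofPred_eq]
  constructor
  · intro h
    conv_rhs => rw [← List.ofFn_get l]
    congr 1
    ext m
    rw [h]
  · intro h m
    have h2 : List.ofFn (fun i : Fin l.length => x i) = List.ofFn l.get := by
      rw [h, List.ofFn_get]
    exact congrFun (List.ofFn_injective h2) m

lemma mem_cyl_iff_of_length {n : ℕ} {l : Word N} (hl : l.length = n) {x : ℕ → Fin N} :
    x ∈ cyl l ↔ seqPrefix n x = l := by
  subst hl; exact mem_cyl_iff

lemma cyl_append (a b : Word N) : cyl (a ++ b) = cyl a ∩ (shift N)^[a.length] ⁻¹' cyl b := by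
  ext x
  rw [Set.mem_inter_iff, Set.mem_preimage, mem_cyl_iff, mem_cyl_iff, mem_cyl_iff,
    List.length_append, seqPrefix_add]
  constructor
  · intro h
    exact List.append_inj h (by simp)
  · rintro ⟨h1, h2⟩
    rw [h1, h2]

lemma continuous_shift : Continuous (shift N) :=
  continuous_pi fun n => continuous_apply (n + 1)

lemma measurable_shift : Measurable (shift N) :=
  measurable_pi_lambda _ fun n => measurable_pi_apply (n + 1)

lemma isClopen_cyl (l : Word N) : IsClopen (cyl l) := by
  have : cyl l = ⋂ m : Fin l.length, (fun x : ℕ → Fin N => x m) ⁻¹' {l.get m} := by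
    ext x; simp [cyl]
  rw [this]
  exact isClopen_iInter_of_finite fun m => (isClopen_discrete _).preimage (continuous_apply _)

lemma measurableSet_cyl (l : Word N) : MeasurableSet (cyl l) := by
  have : cyl l = ⋂ m : Fin l.length, (fun x : ℕ → Fin N => x m) ⁻¹' {l.get m} := by
    ext x; simp [cyl]
  rw [this]
  exact MeasurableSet.iInter fun m => measurable_pi_apply _ (measurableSet_singleton _)

lemma cyl_nil : cyl ([] : Word N) = Set.univ := by
  ext x; simp [cyl]

/-- Decomposition of the measure of a set along the cylinders of a given length. -/
lemma measureReal_eq_wordSum (μ : Measure (ℕ → Fin N)) [IsFiniteMeasure μ]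
    {S : Set (ℕ → Fin N)} (hS : MeasurableSet S) (n : ℕ) :
    μ.real S = wordSum n fun a => μ.real (S ∩ cyl a) := by
  unfold wordSum
  have : S = ⋃ f : Fin n → Fin N, S ∩ cyl (List.ofFn f) := by
    ext x
    simp only [Set.mem_iUnion, Set.mem_inter_iff]
    constructor
    · intro h
      refine ⟨fun i => x i, h, ?_⟩
      rw [mem_cyl_iff_of_length (List.length_ofFn)]
      rfl
    · rintro ⟨_, h, _⟩; exact h
  conv_lhs => rw [this]
  rw [measureReal_iUnion_fintype]
  · intro f g hfg
    rw [Function.onFun, Set.disjoint_left]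
    rintro x ⟨_, hx⟩ ⟨_, hy⟩
    rw [mem_cyl_iff_of_length (List.length_ofFn)] at hx hy
    exact hfg (List.ofFn_injective (hx.symm.trans hy))
  · intro f
    exact hS.inter (measurableSet_cyl _)

lemma measureReal_cyl_append_right (μ : Measure (ℕ → Fin N)) [IsFiniteMeasure μ]
    (l : Word N) (n : ℕ) :
    μ.real (cyl l) = wordSum n fun a => μ.real (cyl (l ++ a)) := by
  have h : μ.real (cyl l) = wordSum (l.length + n) fun a => μ.real (cyl l ∩ cyl a) :=
    measureReal_eq_wordSum μ (measurableSet_cyl l) _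
  rw [h, wordSum_add]
  rw [← wordSum_ite_eq l fun l => wordSum n fun a => μ.real (cyl (l ++ a))]
  apply wordSum_congr
  intro a ha
  split_ifs with hal
  · subst hal
    apply wordSum_congr
    intro b _
    congr 1
    rw [cyl_append, ← Set.inter_assoc, Set.inter_self]
  · have : wordSum n (fun _ : Word N => (0 : ℝ)) = 0 := by simp [wordSum]
    rw [← this]
    apply wordSum_congr
    intro b _
    have : cyl l ∩ cyl (a ++ b) = ∅ := by
      rw [Set.eq_empty_iff_forall_notMem]
      rintro x ⟨hx, hy⟩
      rw [cyl_append] at hy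
      have hy := hy.1
      rw [mem_cyl_iff] at hx
      rw [mem_cyl_iff_of_length ha] at hy
      exact hal (hy.symm.trans hx)
    rw [this, measureReal_empty]

lemma IsInvProb.measurePreserving {μ : Measure (ℕ → Fin N)} (h : IsInvProb μ) :
    MeasurePreserving (shift N) μ μ := ⟨measurable_shift, h.2⟩

lemma IsInvProb.measureReal_preimage {μ : Measure (ℕ → Fin N)} (h : IsInvProb μ)
    {S : Set (ℕ → Fin N)} (hS : MeasurableSet S) (n : ℕ) :
    μ.real ((shift N)^[n] ⁻¹' S) = μ.real S := by
  simp only [Measure.real, (h.measurePreserving.iterate n).measure_preimage hS.nullMeasurableSet]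

lemma IsInvProb.measureReal_cyl_append_left {μ : Measure (ℕ → Fin N)} (h : IsInvProb μ)
    (l : Word N) (n : ℕ) :
    μ.real (cyl l) = wordSum n fun a => μ.real (cyl (a ++ l)) := by
  have := h.1
  rw [← h.measureReal_preimage (measurableSet_cyl l) n,
    measureReal_eq_wordSum μ ((measurable_shift.iterate n) (measurableSet_cyl l)) n]
  apply wordSum_congr
  intro a ha
  rw [cyl_append, ha, Set.inter_comm]

lemma wordSum_measureReal_cyl (μ : Measure (ℕ → Fin N)) [IsProbabilityMeasure μ] (n : ℕ) :
    (wordSum n fun a => μ.real (cyl a)) = 1 := by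
  have := measureReal_cyl_append_right μ [] n
  simp only [cyl_nil, List.nil_append, probReal_univ] at this
  exact this.symm

/-- The union of the cylinders given by words of length `n` satisfying `p`. -/
def prefixSet (n : ℕ) (p : Word N → Prop) : Set (ℕ → Fin N) := {x | p (seqPrefix n x)}

lemma measurableSet_prefixSet (n : ℕ) (p : Word N → Prop) : MeasurableSet (prefixSet n p) := by
  have : prefixSet n p = ⋃ f : Fin n → Fin N, ⋃ _ : p (List.ofFn f), cyl (List.ofFn f) := by
    ext x
    simp only [prefixSet, Set.mem_ofPred_eq, Set.mem_iUnion, exists_prop]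
    constructor
    · intro h
      refine ⟨fun i => x i, h, ?_⟩
      rw [mem_cyl_iff_of_length (List.length_ofFn)]
      rfl
    · rintro ⟨f, h, hx⟩
      rw [mem_cyl_iff_of_length (List.length_ofFn)] at hx
      rwa [hx]
  rw [this]
  exact MeasurableSet.iUnion fun f => MeasurableSet.iUnion fun _ => measurableSet_cyl _

lemma exists_eq_prefixSet {t : Set (ℕ → Fin N)}
    (ht : t ∈ measurableCylinders fun _ : ℕ => Fin N) :
    ∃ n, ∃ p : Word N → Prop, t = prefixSet n p := by
  obtain ⟨s, T, -, rfl⟩ := (mem_measurableCylinders _).1 ht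
  obtain ⟨n, hn⟩ := s.exists_nat_subset_range
  refine ⟨n, fun l => ∃ x ∈ cylinder s T, seqPrefix n x = l, ?_⟩
  ext x
  simp only [prefixSet, Set.mem_ofPred_eq]
  constructor
  · intro hx
    exact ⟨x, hx, rfl⟩
  · rintro ⟨y, hy, hxy⟩
    rw [mem_cylinder] at hy ⊢
    have : s.restrict x = s.restrict y := by
      ext ⟨i, hi⟩
      have hi' : i < n := Finset.mem_range.1 (hn hi)
      have := congrFun (List.ofFn_injective hxy) ⟨i, hi'⟩
      simp only [Finset.restrict]
      simp only at this
      rw [this]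
    rwa [this]

lemma exists_prefixSet_symmDiff_lt (μ : Measure (ℕ → Fin N)) [IsFiniteMeasure μ]
    {S : Set (ℕ → Fin N)} (hS : MeasurableSet S) {ε : ENNReal} (hε : 0 < ε) :
    ∃ n, ∃ p : Word N → Prop, μ (symmDiff (prefixSet n p) S) < ε := by
  obtain ⟨t, ht, hlt⟩ := exists_measure_symmDiff_lt_of_generateFrom_isSetRing (μ := μ)
    (C := measurableCylinders fun _ : ℕ => Fin N) isSetRing_measurableCylinders
    ⟨{Set.univ}, Set.countable_singleton _, by
      simpa using univ_mem_measurableCylinders fun _ : ℕ => Fin N, by simp⟩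
    (generateFrom_measurableCylinders).symm hS hε
  obtain ⟨n, p, rfl⟩ := exists_eq_prefixSet ht
  exact ⟨n, p, hlt⟩

lemma measureReal_prefixSet (μ : Measure (ℕ → Fin N)) [IsFiniteMeasure μ] (n : ℕ)
    (p : Word N → Prop) [DecidablePred p] :
    μ.real (prefixSet n p) = wordSum n fun a => if p a then μ.real (cyl a) else 0 := by
  rw [measureReal_eq_wordSum μ (measurableSet_prefixSet n p) n]
  apply wordSum_congr
  intro a ha
  split_ifs with h
  · congr 1
    apply Set.inter_eq_right.2
    intro x hx
    rw [mem_cyl_iff_of_length ha] at hx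
    simpa only [prefixSet, Set.mem_ofPred_eq, hx]
  · have : prefixSet n p ∩ cyl a = ∅ := by
      rw [Set.eq_empty_iff_forall_notMem]
      rintro x ⟨hx, hy⟩
      rw [mem_cyl_iff_of_length ha] at hy
      simp only [prefixSet, Set.mem_ofPred_eq, hy] at hx
      exact h hx
    rw [this, measureReal_empty]

/-- Two probability measures agreeing on cylinders are equal. -/
lemma measure_ext_of_cyl {μ ν : Measure (ℕ → Fin N)} [IsProbabilityMeasure μ]
    [IsProbabilityMeasure ν] (h : ∀ l : Word N, μ.real (cyl l) = ν.real (cyl l)) : μ = ν := by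
  refine ext_of_generate_finite (measurableCylinders fun _ : ℕ => Fin N)
    generateFrom_measurableCylinders.symm isPiSystem_measurableCylinders (fun t ht => ?_)
    (by simp)
  obtain ⟨n, p, rfl⟩ := exists_eq_prefixSet ht
  classical
  rw [← measureReal_eq_measureReal_iff, measureReal_prefixSet, measureReal_prefixSet]
  simp_rw [h]

end Prefix

section Fekete

lemma Subadditive.mul_le_of_tendsto {u : ℕ → ℝ} (hu : Subadditive u) {L : ℝ}
    (h : Tendsto (fun n => u n / n) atTop (𝓝 L)) (n : ℕ) : n * L ≤ u n := by
  have hb : BddBelow (Set.range fun n => u n / n) := h.bddBelow_range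
  have hL : L = hu.lim := tendsto_nhds_unique h (hu.tendsto_lim hb)
  rcases Nat.eq_zero_or_pos n with rfl | hn
  · have := hu 0 0
    simp at this ⊢
    linarith
  · have := hu.lim_le_div hb hn.ne'
    rw [← hL, le_div_iff₀ (by positivity)] at this
    linarith

lemma Subadditive.tendsto_liminf {u : ℕ → ℝ} (hu : Subadditive u) {c : ℝ}
    (hc : ∀ n : ℕ, n * c ≤ u n) :
    Tendsto (fun n => u n / n) atTop (𝓝 (liminf (fun n : ℕ => (1 / n : ℝ) * u n) atTop)) := by
  have hb : BddBelow (Set.range fun n => u n / n) := by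
    refine ⟨min c 0, ?_⟩
    rintro _ ⟨n, rfl⟩
    rcases Nat.eq_zero_or_pos n with rfl | hn
    · simp
    · refine (min_le_left _ _).trans ?_
      simp only
      rw [le_div_iff₀ (by positivity), mul_comm]
      exact hc n
  have h := hu.tendsto_lim hb
  have : (fun n : ℕ => (1 / n : ℝ) * u n) = fun n => u n / n := by
    ext n; ring
  rw [this, h.liminf_eq]
  exact h

end Fekete

/-- A positive submultiplicative potential with at most exponential decay. -/
structure IsPotential {N : ℕ} (Φ : Word N → ℝ) : Prop where
  submult : Submult Φ
  exists_pow_le : ∃ κ : ℝ, 0 < κ ∧ ∀ l : Word N, κ ^ l.length ≤ Φ l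

section Pressure
variable {N : ℕ} [NeZero N] {Φ : Word N → ℝ}

omit [NeZero N] in
lemma IsPotential.pos (h : IsPotential Φ) (l : Word N) : 0 < Φ l := by
  obtain ⟨κ, hκ, H⟩ := h.exists_pow_le
  exact (pow_pos hκ _).trans_le (H l)

lemma IsPotential.wordSum_pos (h : IsPotential Φ) (n : ℕ) : 0 < wordSum n Φ :=
  _root_.wordSum_pos fun l _ => h.pos l

omit [NeZero N] in
lemma IsPotential.wordSum_add_le (h : IsPotential Φ) (n m : ℕ) :
    wordSum (n + m) Φ ≤ wordSum n Φ * wordSum m Φ := by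
  rw [wordSum_add, ← wordSum_mul_right]
  refine wordSum_le fun a _ => ?_
  rw [← wordSum_mul_left]
  exact wordSum_le fun b _ => h.submult a b

lemma IsPotential.subadditive_log (h : IsPotential Φ) :
    Subadditive fun n => Real.log (wordSum n Φ) := by
  intro n m
  rw [← Real.log_mul (h.wordSum_pos n).ne' (h.wordSum_pos m).ne']
  exact Real.log_le_log (h.wordSum_pos _) (h.wordSum_add_le n m)

lemma IsPotential.tendsto_pressure (h : IsPotential Φ) :
    Tendsto (fun n : ℕ => Real.log (wordSum n Φ) / n) atTop (𝓝 (pressure Φ)) := by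
  obtain ⟨κ, hκ, H⟩ := h.exists_pow_le
  refine h.subadditive_log.tendsto_liminf (c := Real.log κ) fun n => ?_
  rw [← Real.log_pow]
  refine Real.log_le_log (by positivity) ?_
  have hl : (List.replicate n (0 : Fin N)).length = n := by simp
  have h1 := le_wordSum (l := List.replicate n (0 : Fin N)) (g := Φ) fun a _ => (h.pos a).le
  have h2 := H (List.replicate n (0 : Fin N))
  rw [hl] at h1 h2
  exact h2.trans h1

lemma IsPotential.exp_pressure_le (h : IsPotential Φ) (n : ℕ) :
    Real.exp (n * pressure Φ) ≤ wordSum n Φ := by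
  rw [← Real.le_log_iff_exp_le (h.wordSum_pos n)]
  exact h.subadditive_log.mul_le_of_tendsto h.tendsto_pressure n

lemma IsPotential.wordSum_le_exp_pressure (h : IsPotential Φ) {C : ℝ} (hC : 0 < C)
    (H : ∀ n m, wordSum n Φ * wordSum m Φ ≤ C * wordSum (n + m) Φ) (n : ℕ) :
    wordSum n Φ ≤ C * Real.exp (n * pressure Φ) := by
  have hv : Subadditive fun n => Real.log C - Real.log (wordSum n Φ) := by
    intro n m
    have := Real.log_le_log (mul_pos (h.wordSum_pos n) (h.wordSum_pos m)) (H n m)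
    rw [Real.log_mul (h.wordSum_pos n).ne' (h.wordSum_pos m).ne',
      Real.log_mul hC.ne' (h.wordSum_pos _).ne'] at this
    linarith
  have ht : Tendsto (fun n : ℕ => (Real.log C - Real.log (wordSum n Φ)) / n) atTop
      (𝓝 (-pressure Φ)) := by
    have h1 : Tendsto (fun n : ℕ => Real.log C / n) atTop (𝓝 0) :=
      tendsto_const_div_atTop_nhds_zero_nat _
    simpa only [sub_div, zero_sub] using h1.sub h.tendsto_pressure
  have := hv.mul_le_of_tendsto ht n
  rw [← Real.log_le_log_iff (h.wordSum_pos n) (by positivity),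
    Real.log_mul hC.ne' (Real.exp_pos _).ne', Real.log_exp]
  linarith

lemma IsPotential.pressure_mono {Ψ : Word N → ℝ} (h : IsPotential Φ) (h' : IsPotential Ψ)
    (H : ∀ l, Φ l ≤ Ψ l) : pressure Φ ≤ pressure Ψ := by
  refine le_of_tendsto_of_tendsto' h.tendsto_pressure h'.tendsto_pressure fun n => ?_
  refine div_le_div_of_nonneg_right ?_ (by positivity)
  exact Real.log_le_log (h.wordSum_pos n) (wordSum_le fun l _ => H l)

omit [NeZero N] in
lemma subadditive_average {μ : Measure (ℕ → Fin N)} (hμ : IsInvProb μ) (h : IsPotential Φ) :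
    Subadditive fun n => wordSum n fun l => μ.real (cyl l) * Real.log (Φ l) := by
  have := hμ.1
  intro n m
  calc wordSum (n + m) (fun l => μ.real (cyl l) * Real.log (Φ l))
      ≤ wordSum n fun a => wordSum m fun b => (μ.real (cyl (a ++ b)) * Real.log (Φ a) +
          μ.real (cyl (a ++ b)) * Real.log (Φ b)) := by
        rw [wordSum_add]
        refine wordSum_le fun a _ => wordSum_le fun b _ => ?_
        rw [← mul_add, ← Real.log_mul (h.pos a).ne' (h.pos b).ne']
        exact mul_le_mul_of_nonneg_left (Real.log_le_log (h.pos _) (h.submult a b))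
          measureReal_nonneg
    _ = _ := by
        simp_rw [wordSum_add_fun, wordSum_mul_right]
        congr 1
        · refine wordSum_congr fun a _ => ?_
          rw [← measureReal_cyl_append_right]
        · rw [wordSum_comm]
          refine wordSum_congr fun a _ => ?_
          rw [wordSum_mul_right, ← hμ.measureReal_cyl_append_left]

omit [NeZero N] in
lemma tendsto_lambdaAvg {μ : Measure (ℕ → Fin N)} (hμ : IsInvProb μ) (h : IsPotential Φ) :
    Tendsto (fun n : ℕ => (wordSum n fun l => μ.real (cyl l) * Real.log (Φ l)) / n) atTop
      (𝓝 (lambdaAvg Φ μ)) := by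
  have := hμ.1
  obtain ⟨κ, hκ, H⟩ := h.exists_pow_le
  refine (subadditive_average hμ h).tendsto_liminf (c := Real.log κ) fun n => ?_
  rw [← Real.log_pow, ← one_mul (Real.log _), ← wordSum_measureReal_cyl μ n, ← wordSum_mul_right]
  refine wordSum_le fun l hl => mul_le_mul_of_nonneg_left ?_ measureReal_nonneg
  have := H l
  rw [hl] at this
  exact Real.log_le_log (by positivity) this

lemma negMulLog_le_of_le {p a b : ℝ} (hp : 0 ≤ p) (ha : p ≤ a) (hb : p ≤ b) :
    Real.negMulLog p ≤ -(p * Real.log a) - p * Real.log b + (a * b - p) := by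
  rcases hp.eq_or_lt with rfl | hp
  · simp; positivity
  · have ha' := hp.trans_le ha
    have hb' := hp.trans_le hb
    have h1 := Real.log_le_sub_one_of_pos (x := a * b / p) (by positivity)
    rw [Real.log_div (by positivity) hp.ne', Real.log_mul ha'.ne' hb'.ne'] at h1
    have h2 := mul_le_mul_of_nonneg_left h1 hp.le
    have h3 : p * (a * b / p - 1) = a * b - p := by field_simp
    rw [h3] at h2
    unfold Real.negMulLog
    linarith

omit [NeZero N] in
lemma subadditive_entropy {μ : Measure (ℕ → Fin N)} (hμ : IsInvProb μ) :
    Subadditive fun n => wordSum n fun l => Real.negMulLog (μ.real (cyl l)) := by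
  have := hμ.1
  intro n m
  calc wordSum (n + m) (fun l => Real.negMulLog (μ.real (cyl l)))
      ≤ wordSum n fun a => wordSum m fun b =>
          (-(μ.real (cyl (a ++ b)) * Real.log (μ.real (cyl a)))
            - μ.real (cyl (a ++ b)) * Real.log (μ.real (cyl b))
            + (μ.real (cyl a) * μ.real (cyl b) - μ.real (cyl (a ++ b)))) := by
        rw [wordSum_add]
        refine wordSum_le fun a _ => wordSum_le fun b _ => ?_
        refine negMulLog_le_of_le measureReal_nonneg ?_ ?_
        · rw [cyl_append]
          exact measureReal_mono Set.inter_subset_left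
        · rw [cyl_append, ← hμ.measureReal_preimage (measurableSet_cyl b) a.length]
          exact measureReal_mono Set.inter_subset_right
    _ = (wordSum n fun a => -(μ.real (cyl a) * Real.log (μ.real (cyl a)))) -
        (wordSum m fun b => μ.real (cyl b) * Real.log (μ.real (cyl b))) := by
        simp_rw [wordSum_add_fun, wordSum_sub_fun]
        have h1 : (wordSum n fun a => wordSum m fun b => μ.real (cyl (a ++ b)) *
            Real.log (μ.real (cyl b))) =
            wordSum m fun b => μ.real (cyl b) * Real.log (μ.real (cyl b)) := by
          rw [wordSum_comm]
          refine wordSum_congr fun a _ => ?_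
          rw [wordSum_mul_right, ← hμ.measureReal_cyl_append_left]
        have h2 : (wordSum n fun a => wordSum m fun b => μ.real (cyl a) * μ.real (cyl b)) = 1 := by
          rw [← wordSum_measureReal_cyl μ n]
          refine wordSum_congr fun a _ => ?_
          rw [wordSum_mul_left, wordSum_measureReal_cyl, mul_one]
        have h3 : (wordSum n fun a => wordSum m fun b => μ.real (cyl (a ++ b))) = 1 := by
          simp_rw [← measureReal_cyl_append_right]
          exact wordSum_measureReal_cyl μ n
        have h4 : (wordSum n fun a => wordSum m fun b => -(μ.real (cyl (a ++ b)) *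
            Real.log (μ.real (cyl a)))) =
            wordSum n fun a => -(μ.real (cyl a) * Real.log (μ.real (cyl a))) := by
          refine wordSum_congr fun a _ => ?_
          simp_rw [← mul_neg]
          rw [wordSum_mul_right, ← measureReal_cyl_append_right]
        rw [h1, h2, h3, h4]
        ring
    _ = _ := by
        simp [wordSum, Real.negMulLog, sub_eq_add_neg]

omit [NeZero N] in
lemma tendsto_mEntropy {μ : Measure (ℕ → Fin N)} (hμ : IsInvProb μ) :
    Tendsto (fun n : ℕ => (wordSum n fun l => Real.negMulLog (μ.real (cyl l))) / n) atTop
      (𝓝 (mEntropy μ)) := by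
  have := hμ.1
  refine (subadditive_entropy hμ).tendsto_liminf (c := 0) fun n => ?_
  rw [mul_zero]
  exact wordSum_nonneg fun l _ => Real.negMulLog_nonneg measureReal_nonneg measureReal_le_one

omit [NeZero N] in
/-- For an equilibrium state, the finite-level entropy plus energy dominates the pressure. -/
lemma IsEqState.mul_pressure_le {μ : Measure (ℕ → Fin N)} (hμ : IsEqState Φ μ)
    (h : IsPotential Φ) (n : ℕ) :
    n * pressure Φ ≤ (wordSum n fun l => Real.negMulLog (μ.real (cyl l))) +
      wordSum n fun l => μ.real (cyl l) * Real.log (Φ l) := by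
  rw [← hμ.2, mul_add]
  exact add_le_add
    ((subadditive_entropy hμ.1).mul_le_of_tendsto (tendsto_mEntropy hμ.1) n)
    ((subadditive_average hμ.1 h).mul_le_of_tendsto (tendsto_lambdaAvg hμ.1 h) n)

omit [NeZero N] in
/-- An invariant Gibbs measure is an equilibrium state. -/
lemma GibbsWith.isEqState {μ : Measure (ℕ → Fin N)} (hμ : IsInvProb μ) (h : IsPotential Φ)
    {C : ℝ} (hC : GibbsWith Φ μ C) : IsEqState Φ μ := by
  have := hμ.1
  refine ⟨hμ, ?_⟩
  obtain ⟨hC0, hC⟩ := hC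
  have ht := (tendsto_mEntropy hμ).add (tendsto_lambdaAvg hμ h)
  refine tendsto_nhds_unique ht ?_
  have key : ∀ n : ℕ, |((wordSum n fun l => Real.negMulLog (μ.real (cyl l))) +
      wordSum n fun l => μ.real (cyl l) * Real.log (Φ l)) - n * pressure Φ| ≤ Real.log C := by
    intro n
    have e : ((wordSum n fun l => Real.negMulLog (μ.real (cyl l))) +
      wordSum n fun l => μ.real (cyl l) * Real.log (Φ l)) - n * pressure Φ =
        wordSum n fun l => μ.real (cyl l) *
          (Real.log (Φ l) - Real.log (μ.real (cyl l)) - n * pressure Φ) := by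
      have : (n * pressure Φ : ℝ) = wordSum n fun l => μ.real (cyl l) * (n * pressure Φ) := by
        rw [wordSum_mul_right, wordSum_measureReal_cyl, one_mul]
      conv_lhs => rw [this, ← wordSum_add_fun, ← wordSum_sub_fun]
      refine wordSum_congr fun l _ => ?_
      unfold Real.negMulLog
      ring
    rw [e]
    have hb : ∀ l : Word N, l.length = n →
        |Real.log (Φ l) - Real.log (μ.real (cyl l)) - n * pressure Φ| ≤ Real.log C := by
      intro l hl
      obtain ⟨h1, h2⟩ := hC l
      rw [hl] at h1 h2
      have hΦ := h.pos l
      have hm : 0 < μ.real (cyl l) := by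
        have : 0 < (μ (cyl l)).toReal * Real.exp (n * pressure Φ) :=
          lt_of_lt_of_le (by positivity) h1
        exact pos_of_mul_pos_left this (Real.exp_pos _).le
      have hm' : 0 < (μ (cyl l)).toReal := hm
      have h1' := Real.log_le_log (by positivity) h1
      have h2' := Real.log_le_log (by positivity) h2
      rw [Real.log_mul (by positivity) (by positivity),
        Real.log_mul (by positivity) (by positivity),
        Real.log_exp] at h1' h2'
      rw [Real.log_inv] at h1'
      rw [abs_le]
      simp only [Measure.real]
      constructor <;> linarith
    rw [abs_le]
    have e2 : Real.log C = wordSum n fun l => μ.real (cyl l) * Real.log C := by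
      rw [wordSum_mul_right, wordSum_measureReal_cyl, one_mul]
    constructor
    · rw [← mul_one (Real.log C), ← wordSum_measureReal_cyl μ n, ← neg_mul, ← wordSum_mul_left]
      refine wordSum_le fun l hl => ?_
      rw [mul_comm]
      exact mul_le_mul_of_nonneg_left (abs_le.1 (hb l hl)).1 measureReal_nonneg
    · rw [e2]
      refine wordSum_le fun l hl => ?_
      exact mul_le_mul_of_nonneg_left (abs_le.1 (hb l hl)).2 measureReal_nonneg
  rw [tendsto_iff_dist_tendsto_zero]
  have h1 : Tendsto (fun n : ℕ => Real.log C / n) atTop (𝓝 0) :=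
    tendsto_const_div_atTop_nhds_zero_nat _
  refine squeeze_zero' (Eventually.of_forall fun _ => dist_nonneg) ?_ h1
  filter_upwards [eventually_gt_atTop 0] with n hn
  have hn' : (0 : ℝ) < n := by exact_mod_cast hn
  rw [Real.dist_eq, ← add_div]
  rw [div_sub' hn'.ne', abs_div, abs_of_pos hn']
  exact div_le_div_of_nonneg_right (key n) hn'.le

end Pressure

section AbsolutelyContinuous
variable {N : ℕ} {Φ : Word N → ℝ}

lemma measureReal_le_add_symmDiff {X : Type*} [MeasurableSpace X] (μ : Measure X)
    [IsFiniteMeasure μ] (s t : Set X) : μ.real s ≤ μ.real t + μ.real (symmDiff t s) := by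
  refine (measureReal_mono (s₂ := t ∪ symmDiff t s) ?_).trans (measureReal_union_le _ _)
  intro x hx
  by_cases h : x ∈ t
  · exact Or.inl h
  · exact Or.inr (Or.inr ⟨hx, h⟩)

/-- A measure satisfying the lower Gibbs bound dominates every equilibrium state. -/
lemma IsEqState.absolutelyContinuous {ν μ : Measure (ℕ → Fin N)} [IsFiniteMeasure μ]
    (hν : IsEqState Φ ν) (h : IsPotential Φ) {c : ℝ} (hc : 0 < c)
    (H : ∀ l : Word N, c * Φ l ≤ μ.real (cyl l) * Real.exp (l.length * pressure Φ)) :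
    ν ≪ μ := by
  have := hν.1.1
  have hμpos : ∀ l : Word N, 0 < μ.real (cyl l) := fun l =>
    pos_of_mul_pos_left ((mul_pos hc (h.pos l)).trans_le (H l)) (Real.exp_pos _).le
  set f : Word N → ℝ := fun l =>
    ν.real (cyl l) * (Real.log (ν.real (cyl l)) - Real.log (μ.real (cyl l))) + μ.real (cyl l)
    with hf
  have hf0 : ∀ l, 0 ≤ f l := by
    intro l
    simp only [hf]
    rcases (measureReal_nonneg (μ := ν) (s := cyl l)).eq_or_lt with h0 | h0
    · rw [← h0]; simp
    · have h1 := Real.log_le_sub_one_of_pos (div_pos (hμpos l) h0)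
      rw [Real.log_div (hμpos l).ne' h0.ne'] at h1
      have h2 := mul_le_mul_of_nonneg_left h1 h0.le
      have h3 : ν.real (cyl l) * (μ.real (cyl l) / ν.real (cyl l) - 1) =
        μ.real (cyl l) - ν.real (cyl l) := by field_simp
      rw [h3] at h2
      linarith
  set K : ℝ := -Real.log c + μ.real Set.univ with hK
  have hsum : ∀ n, wordSum n f ≤ K := by
    intro n
    have e1 : wordSum n (fun l => μ.real (cyl l)) = μ.real Set.univ := by
      rw [measureReal_eq_wordSum μ MeasurableSet.univ n]
      simp
    have e2 : wordSum n (fun l => ν.real (cyl l) *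
        (Real.log (ν.real (cyl l)) - Real.log (μ.real (cyl l)))) ≤
        wordSum n fun l => (ν.real (cyl l) * (-Real.log c + n * pressure Φ) -
          Real.negMulLog (ν.real (cyl l)) - ν.real (cyl l) * Real.log (Φ l)) := by
      refine wordSum_le fun l hl => ?_
      have h1 := Real.log_le_log (mul_pos hc (h.pos l)) (H l)
      rw [Real.log_mul hc.ne' (h.pos l).ne', Real.log_mul (hμpos l).ne' (Real.exp_pos _).ne',
        Real.log_exp, hl] at h1
      have h2 : Real.log (ν.real (cyl l)) - Real.log (μ.real (cyl l)) ≤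
          Real.log (ν.real (cyl l)) - Real.log c - Real.log (Φ l) + n * pressure Φ := by linarith
      refine (mul_le_mul_of_nonneg_left h2 measureReal_nonneg).trans (le_of_eq ?_)
      unfold Real.negMulLog
      ring
    rw [wordSum_sub_fun, wordSum_sub_fun, wordSum_mul_right, wordSum_measureReal_cyl] at e2
    have e3 := hν.mul_pressure_le h n
    simp only [hf]
    rw [wordSum_add_fun, e1]
    linarith
  have main : ∀ (M : ℝ), 0 < M → ∀ n (p : Word N → Prop),
      ν.real (prefixSet n p) ≤ Real.exp M * μ.real (prefixSet n p) + K / M := by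
    intro M hM n p
    classical
    rw [measureReal_prefixSet, measureReal_prefixSet, ← wordSum_mul_left]
    refine le_trans ?_ (add_le_add le_rfl (div_le_div_of_nonneg_right (hsum n) hM.le))
    rw [← wordSum_div, ← wordSum_add_fun]
    refine wordSum_le fun l _ => ?_
    split_ifs with hp
    · by_cases hb : ν.real (cyl l) ≤ Real.exp M * μ.real (cyl l)
      · have := div_nonneg (hf0 l) hM.le
        linarith
      · push Not at hb
        have hν0 : 0 < ν.real (cyl l) := lt_of_le_of_lt (by have := hμpos l; positivity) hb
        have h1 := Real.log_le_log (mul_pos (Real.exp_pos M) (hμpos l)) hb.le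
        rw [Real.log_mul (Real.exp_pos _).ne' (hμpos l).ne', Real.log_exp] at h1
        have h2 : ν.real (cyl l) * M ≤ f l := by
          have := mul_le_mul_of_nonneg_left
            (show M ≤ Real.log (ν.real (cyl l)) - Real.log (μ.real (cyl l)) by linarith) hν0.le
          simp only [hf]
          linarith [hμpos l]
        rw [← le_div_iff₀ hM] at h2
        have := mul_pos (Real.exp_pos M) (hμpos l)
        linarith
    · have := div_nonneg (hf0 l) hM.le
      simpa using this
  refine Measure.AbsolutelyContinuous.mk fun A hA hμA => ?_
  have hbound : ∀ M : ℝ, 0 < M → ∀ ε : ℝ, 0 < ε →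
      ν.real A ≤ Real.exp M * ε + K / M + ε := by
    intro M hM ε hε
    obtain ⟨n, p, hlt⟩ := exists_prefixSet_symmDiff_lt (μ + ν) hA (ENNReal.ofReal_pos.2 hε)
    have hlt' : (μ + ν).real (symmDiff (prefixSet n p) A) ≤ ε := by
      rw [Measure.real]
      exact ENNReal.toReal_le_of_le_ofReal hε.le hlt.le
    rw [measureReal_add_apply] at hlt'
    have n1 : 0 ≤ μ.real (symmDiff (prefixSet n p) A) := measureReal_nonneg
    have n2 : 0 ≤ ν.real (symmDiff (prefixSet n p) A) := measureReal_nonneg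
    have h1 := measureReal_le_add_symmDiff ν A (prefixSet n p)
    have h2 := measureReal_le_add_symmDiff μ (prefixSet n p) A
    rw [symmDiff_comm] at h2
    have h3 : μ.real A = 0 := by rw [Measure.real, hμA]; rfl
    have h4 := main M hM n p
    have h5 : Real.exp M * μ.real (prefixSet n p) ≤ Real.exp M * ε :=
      mul_le_mul_of_nonneg_left (by linarith) (Real.exp_pos _).le
    linarith
  have hbound2 : ∀ M : ℝ, 0 < M → ν.real A ≤ K / M := by
    intro M hM
    refine le_of_forall_pos_le_add fun η hη => ?_
    have := hbound M hM (η / (Real.exp M + 1)) (by positivity)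
    have e : Real.exp M * (η / (Real.exp M + 1)) + K / M + η / (Real.exp M + 1) = K / M + η := by
      have : Real.exp M + 1 ≠ 0 := by positivity
      field_simp
      ring
    linarith
  have hzero : ν.real A ≤ 0 := by
    have ht : Tendsto (fun n : ℕ => K / n) atTop (nhds 0) :=
      tendsto_const_div_atTop_nhds_zero_nat _
    refine ge_of_tendsto ht ?_
    filter_upwards [eventually_gt_atTop 0] with n hn
    exact hbound2 n (by exact_mod_cast hn)
  have : ν.real A = 0 := le_antisymm hzero measureReal_nonneg
  exact (measureReal_eq_zero_iff).1 this

end AbsolutelyContinuous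

section Ergodic
variable {N : ℕ} {Φ : Word N → ℝ}

lemma measureReal_eq_wordSum_preimage (μ : Measure (ℕ → Fin N)) [IsFiniteMeasure μ]
    (S : Set (ℕ → Fin N)) (r n : ℕ) :
    μ.real S = wordSum n fun b => μ.real (S ∩ (shift N)^[r] ⁻¹' cyl b) := by
  have hm : Measurable ((shift N)^[r]) := measurable_shift.iterate r
  have h := measureReal_eq_wordSum ((μ.restrict S).map (shift N)^[r]) MeasurableSet.univ n
  rw [map_measureReal_apply hm MeasurableSet.univ, Set.preimage_univ,
    measureReal_restrict_apply MeasurableSet.univ, Set.univ_inter] at h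
  rw [h]
  refine wordSum_congr fun b _ => ?_
  rw [Set.univ_inter, map_measureReal_apply hm (measurableSet_cyl b),
    measureReal_restrict_apply (hm (measurableSet_cyl b)), Set.inter_comm]

lemma measureReal_le_one_of_prob {X : Type*} [MeasurableSpace X] (μ : Measure X)
    [IsProbabilityMeasure μ] (s : Set X) : μ.real s ≤ 1 := measureReal_le_one

/-- The Gibbs property of a quasimultiplicative potential forces cylinders to mix. -/
lemma GibbsWith.exists_mixing {μ : Measure (ℕ → Fin N)} (h : IsPotential Φ)
    (hq : Quasimult Φ) {C : ℝ} (hC : GibbsWith Φ μ C) :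
    ∃ c : ℝ, 0 < c ∧ ∃ F : Finset (Word N), ∀ l m : Word N,
      ∃ j ∈ F, c * (μ.real (cyl l) * μ.real (cyl m)) ≤ μ.real (cyl (l ++ j ++ m)) := by
  obtain ⟨δ, hδ, F, hF⟩ := hq
  obtain ⟨hC0, hC⟩ := hC
  set P := pressure Φ
  obtain ⟨ε, hε, hεF⟩ : ∃ ε : ℝ, 0 < ε ∧ ∀ j ∈ F, ε ≤ Real.exp (-(j.length * P)) := by
    rcases F.eq_empty_or_nonempty with rfl | hne
    · exact ⟨1, one_pos, by simp⟩
    · obtain ⟨j, -, hj⟩ := F.exists_min_image (fun j => Real.exp (-(j.length * P))) hne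
      exact ⟨_, Real.exp_pos _, hj⟩
  refine ⟨C⁻¹ * δ * C⁻¹ * C⁻¹ * ε, by positivity, F, fun l m => ?_⟩
  obtain ⟨j, hj, hlm⟩ := hF l m
  refine ⟨j, hj, ?_⟩
  have h1 := (hC (l ++ j ++ m)).1
  have h2 := (hC l).2
  have h3 := (hC m).2
  have e : Real.exp ((l ++ j ++ m).length * P) =
      Real.exp (l.length * P) * Real.exp (j.length * P) * Real.exp (m.length * P) := by
    rw [← Real.exp_add, ← Real.exp_add]
    congr 1
    push_cast [List.length_append]
    ring
  rw [e] at h1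
  have hj' := hεF j hj
  rw [Real.exp_neg] at hj'
  set el := Real.exp (l.length * P)
  set ej := Real.exp (j.length * P)
  set em := Real.exp (m.length * P)
  have hel : 0 < el := Real.exp_pos _
  have hej : 0 < ej := Real.exp_pos _
  have hem : 0 < em := Real.exp_pos _
  change C⁻¹ * _ ≤ μ.real _ * _ at h1
  change μ.real _ * _ ≤ _ at h2 h3
  have a1 : C⁻¹ * (μ.real (cyl l) * el) ≤ Φ l := by
    rw [inv_mul_le_iff₀ hC0]; exact h2
  have a2 : C⁻¹ * (μ.real (cyl m) * em) ≤ Φ m := by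
    rw [inv_mul_le_iff₀ hC0]; exact h3
  have a3 : (C⁻¹ * (μ.real (cyl l) * el)) * (C⁻¹ * (μ.real (cyl m) * em)) ≤ Φ l * Φ m :=
    mul_le_mul a1 a2 (by have := measureReal_nonneg (μ := μ) (s := cyl m); positivity)
      (h.pos l).le
  have a4 : C⁻¹ * (δ * ((C⁻¹ * (μ.real (cyl l) * el)) * (C⁻¹ * (μ.real (cyl m) * em)))) ≤
      μ.real (cyl (l ++ j ++ m)) * (el * ej * em) := by
    refine le_trans ?_ h1
    refine mul_le_mul_of_nonneg_left ?_ (by positivity)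
    exact (mul_le_mul_of_nonneg_left a3 hδ.le).trans hlm
  have a5 : C⁻¹ * δ * C⁻¹ * C⁻¹ * ε * (μ.real (cyl l) * μ.real (cyl m)) * (el * ej * em) ≤
      C⁻¹ * (δ * ((C⁻¹ * (μ.real (cyl l) * el)) * (C⁻¹ * (μ.real (cyl m) * em)))) := by
    have : ε * ej ≤ 1 := by
      rw [← inv_mul_cancel₀ hej.ne']
      exact mul_le_mul_of_nonneg_right hj' hej.le
    have n1 := measureReal_nonneg (μ := μ) (s := cyl m)
    have n2 := measureReal_nonneg (μ := μ) (s := cyl l)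
    have := mul_le_mul_of_nonneg_left this
      (show 0 ≤ C⁻¹ * (δ * ((C⁻¹ * (μ.real (cyl l) * el)) * (C⁻¹ * (μ.real (cyl m) * em)))) by
        positivity)
    linarith
  exact le_of_mul_le_mul_right (a5.trans a4) (by positivity)

lemma GibbsWith.ergodic {μ : Measure (ℕ → Fin N)} (hμ : IsInvProb μ) (h : IsPotential Φ)
    (hq : Quasimult Φ) {C : ℝ} (hC : GibbsWith Φ μ C) : Ergodic (shift N) μ := by
  have := hμ.1
  obtain ⟨c, hc, F, hF⟩ := hC.exists_mixing h hq
  have mix : ∀ n (p q : Word N → Prop), c * (μ.real (prefixSet n p) * μ.real (prefixSet n q)) ≤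
      ∑ j ∈ F, μ.real (prefixSet n p ∩ (shift N)^[n + j.length] ⁻¹' prefixSet n q) := by
    intro n p q
    classical
    have hmeas : ∀ r, MeasurableSet (prefixSet n p ∩ (shift N)^[r] ⁻¹' prefixSet n q) := fun r =>
      (measurableSet_prefixSet n p).inter
        ((measurable_shift.iterate r) (measurableSet_prefixSet n q))
    have e : ∀ r, μ.real (prefixSet n p ∩ (shift N)^[r] ⁻¹' prefixSet n q) =
        wordSum n fun a => wordSum n fun b =>
          μ.real (prefixSet n p ∩ (shift N)^[r] ⁻¹' prefixSet n q ∩ cyl a ∩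
            (shift N)^[r] ⁻¹' cyl b) := by
      intro r
      rw [measureReal_eq_wordSum μ (hmeas r) n]
      refine wordSum_congr fun a _ => ?_
      rw [measureReal_eq_wordSum_preimage μ _ r n]
    simp_rw [e]
    rw [← wordSum_finset_sum, measureReal_prefixSet μ n p, measureReal_prefixSet μ n q,
      ← wordSum_mul_right, ← wordSum_mul_left]
    refine wordSum_le fun a ha => ?_
    rw [← wordSum_finset_sum, ← wordSum_mul_left, ← wordSum_mul_left]
    refine wordSum_le fun b hb => ?_
    by_cases hp : p a
    swap
    · rw [if_neg hp]
      simp only [zero_mul, mul_zero]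
      exact Finset.sum_nonneg fun _ _ => measureReal_nonneg
    by_cases hq : q b
    swap
    · rw [if_neg hq]
      simp only [mul_zero]
      exact Finset.sum_nonneg fun _ _ => measureReal_nonneg
    rw [if_pos hp, if_pos hq]
    obtain ⟨j, hj, hle⟩ := hF a b
    refine (hle.trans ?_).trans (Finset.single_le_sum
      (f := fun j : Word N => μ.real (prefixSet n p ∩
        (shift N)^[n + j.length] ⁻¹' prefixSet n q ∩ cyl a ∩ (shift N)^[n + j.length] ⁻¹' cyl b))
      (fun _ _ => measureReal_nonneg) hj)
    refine measureReal_mono ?_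
    intro x hx
    rw [cyl_append, cyl_append, List.length_append, ha] at hx
    have hxa : seqPrefix n x = a := (mem_cyl_iff_of_length ha).1 hx.1.1
    have hxb : seqPrefix n ((shift N)^[n + j.length] x) = b := (mem_cyl_iff_of_length hb).1 hx.2
    refine ⟨⟨⟨?_, ?_⟩, hx.1.1⟩, hx.2⟩
    · change p _; rwa [hxa]
    · change q _; rwa [hxb]
  refine ⟨hμ.measurePreserving, ⟨fun B hB hinv => ?_⟩⟩
  have hinvn : ∀ r, (shift N)^[r] ⁻¹' B = B := by
    intro r
    induction r with
    | zero => rfl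
    | succ r ih => rw [Function.iterate_succ, Set.preimage_comp, ih, hinv]
  have key : ∀ ε : ℝ, 0 < ε → c * (μ.real B * μ.real Bᶜ) ≤ (2 * c + 2 * F.card) * ε := by
    intro ε hε
    obtain ⟨n, p, hlt⟩ := exists_prefixSet_symmDiff_lt μ hB (ENNReal.ofReal_pos.2 hε)
    have hlt' : μ.real (symmDiff (prefixSet n p) B) ≤ ε :=
      ENNReal.toReal_le_of_le_ofReal hε.le hlt.le
    set U := prefixSet n p with hU
    have hUc : prefixSet n (fun a => ¬ p a) = Uᶜ := rfl
    have h1 := mix n p fun a => ¬ p a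
    rw [hUc, ← hU] at h1
    have h2 : ∀ r, μ.real (U ∩ (shift N)^[r] ⁻¹' Uᶜ) ≤ 2 * ε := by
      intro r
      have hsub : U ∩ (shift N)^[r] ⁻¹' Uᶜ ⊆
          symmDiff U B ∪ (shift N)^[r] ⁻¹' (symmDiff U B) := by
        rintro x ⟨hx, hx'⟩
        by_cases hb : x ∈ B
        · right
          rw [← hinvn r] at hb
          exact Or.inr ⟨hb, hx'⟩
        · left
          exact Or.inl ⟨hx, hb⟩
      refine (measureReal_mono hsub).trans ((measureReal_union_le _ _).trans ?_)
      rw [hμ.measureReal_preimage ((measurableSet_prefixSet n p).symmDiff hB)]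
      linarith
    have h3 : ∑ j ∈ F, μ.real (U ∩ (shift N)^[n + j.length] ⁻¹' Uᶜ) ≤ F.card * (2 * ε) := by
      rw [← nsmul_eq_mul]
      exact Finset.sum_le_card_nsmul _ _ _ fun j _ => h2 _
    have h4 := measureReal_le_add_symmDiff μ B U
    have h5 := measureReal_le_add_symmDiff μ Bᶜ Uᶜ
    have h6 : symmDiff Uᶜ Bᶜ = symmDiff U B := compl_symmDiff_compl _ _
    rw [h6] at h5
    have b1 := measureReal_le_one_of_prob μ B
    have b2 := measureReal_le_one_of_prob μ Bᶜ
    have b3 := measureReal_le_one_of_prob μ U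
    have b4 := measureReal_le_one_of_prob μ Uᶜ
    have c1 := measureReal_nonneg (μ := μ) (s := B)
    have c2 := measureReal_nonneg (μ := μ) (s := Bᶜ)
    have c3 := measureReal_nonneg (μ := μ) (s := U)
    have c4 := measureReal_nonneg (μ := μ) (s := Uᶜ)
    have h7 : μ.real B * μ.real Bᶜ ≤ μ.real U * μ.real Uᶜ + 2 * ε := by
      have h8 : μ.real B * μ.real Bᶜ ≤ (μ.real U + ε) * μ.real Bᶜ :=
        mul_le_mul_of_nonneg_right (by linarith) c2
      have h9 : μ.real U * μ.real Bᶜ ≤ μ.real U * (μ.real Uᶜ + ε) :=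
        mul_le_mul_of_nonneg_left (by linarith) c3
      nlinarith
    have h10 := mul_le_mul_of_nonneg_left h7 hc.le
    nlinarith
  have hzero : c * (μ.real B * μ.real Bᶜ) ≤ 0 := by
    refine le_of_forall_pos_le_add fun η hη => ?_
    have hpos : 0 < 2 * c + 2 * (F.card : ℝ) := by positivity
    have := key (η / (2 * c + 2 * F.card)) (by positivity)
    rw [mul_div_cancel₀ _ hpos.ne'] at this
    linarith
  have hz : μ.real B * μ.real Bᶜ = 0 := by
    refine le_antisymm ?_ (mul_nonneg measureReal_nonneg measureReal_nonneg)
    by_contra hcon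
    push Not at hcon
    have := mul_pos hc hcon
    linarith
  rw [Filter.eventuallyConst_set']
  rcases mul_eq_zero.1 hz with h0 | h0
  · left
    exact ae_eq_empty.2 ((measureReal_eq_zero_iff).1 h0)
  · right
    rw [Filter.eventuallyEq_univ]
    exact (mem_ae_iff).2 ((measureReal_eq_zero_iff).1 h0)

end Ergodic

section GibbsExistence
variable {N : ℕ}

/-- The average of the first `n + 1` pushforwards of a measure under the shift. -/
noncomputable def shiftAverage (ν : Measure (ℕ → Fin N)) (n : ℕ) : Measure (ℕ → Fin N) :=
  ENNReal.ofReal ((n + 1 : ℝ)⁻¹) • ∑ q ∈ Finset.range (n + 1), ν.map (shift N)^[q]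

lemma shiftAverage_real (ν : Measure (ℕ → Fin N)) [IsProbabilityMeasure ν] (n : ℕ)
    {S : Set (ℕ → Fin N)} (hS : MeasurableSet S) :
    (shiftAverage ν n).real S =
      (n + 1 : ℝ)⁻¹ * ∑ q ∈ Finset.range (n + 1), ν.real ((shift N)^[q] ⁻¹' S) := by
  have hm : ∀ q, Measurable ((shift N)^[q]) := fun q => measurable_shift.iterate q
  unfold shiftAverage
  rw [measureReal_ennreal_smul_apply, ENNReal.toReal_ofReal (by positivity)]
  congr 1
  simp only [Measure.real, Measure.finsetSum_apply]
  rw [ENNReal.toReal_sum]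
  · refine Finset.sum_congr rfl fun q _ => ?_
    rw [Measure.map_apply (hm q) hS]
  · intro q _
    rw [Measure.map_apply (hm q) hS]
    exact measure_ne_top _ _

instance isProbabilityMeasure_shiftAverage (ν : Measure (ℕ → Fin N)) [IsProbabilityMeasure ν]
    (n : ℕ) : IsProbabilityMeasure (shiftAverage ν n) := by
  have hm : ∀ q, Measurable ((shift N)^[q]) := fun q => measurable_shift.iterate q
  have h : ∀ q, (ν.map (shift N)^[q]) Set.univ = 1 := fun q => by
    rw [Measure.map_apply (hm q) MeasurableSet.univ, Set.preimage_univ, measure_univ]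
  constructor
  simp only [shiftAverage, Measure.smul_apply, Measure.finsetSum_apply, h, Finset.sum_const,
    Finset.card_range, smul_eq_mul, nsmul_eq_mul, mul_one]
  rw [← ENNReal.ofReal_natCast, ← ENNReal.ofReal_mul (by positivity)]
  simp only [ENNReal.ofReal_eq_one]
  push_cast
  field_simp

/-- A Krylov–Bogolyubov argument: from probability measures `ν n` one obtains an invariant
measure whose cylinder weights inherit the two-sided bounds of the time averages. -/
lemma exists_isInvProb_of_bounds (ν : ℕ → Measure (ℕ → Fin N)) [∀ n, IsProbabilityMeasure (ν n)] :
    ∃ μ : Measure (ℕ → Fin N), IsInvProb μ ∧ ∀ (l : Word N) (c C : ℝ) (n₀ : ℕ),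
      (∀ n ≥ n₀, ∀ q ≤ n, c ≤ (ν n).real ((shift N)^[q] ⁻¹' cyl l) ∧
        (ν n).real ((shift N)^[q] ⁻¹' cyl l) ≤ C) →
      c ≤ μ.real (cyl l) ∧ μ.real (cyl l) ≤ C := by
  let P : ℕ → ProbabilityMeasure (ℕ → Fin N) := fun n => ⟨shiftAverage (ν n) n, inferInstance⟩
  let F : Ultrafilter ℕ := hyperfilter ℕ
  have hF : (F : Filter ℕ) ≤ atTop := by
    rw [← Nat.cofinite_eq_atTop]; exact hyperfilter_le_cofinite
  obtain ⟨μ, -, hμ⟩ := (isCompact_univ (X := ProbabilityMeasure (ℕ → Fin N))).ultrafilter_le_nhds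
    (F.map P) (by simp)
  have hlim : Tendsto P F (𝓝 μ) := hμ
  have hreal : ∀ S : Set (ℕ → Fin N), IsClopen S →
      Tendsto (fun n => (shiftAverage (ν n) n).real S) F
        (𝓝 ((μ : Measure (ℕ → Fin N)).real S)) := by
    intro S hS
    have := ProbabilityMeasure.tendsto_measure_of_isClopen_of_tendsto hlim hS
    rw [ProbabilityMeasure.measureReal_eq_coe_coeFn]
    refine ((NNReal.continuous_coe.tendsto _).comp this).congr fun n => ?_
    simp only [Function.comp]
    rw [← ProbabilityMeasure.measureReal_eq_coe_coeFn]
    rfl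
  refine ⟨μ, ⟨inferInstance, ?_⟩, ?_⟩
  · have : IsProbabilityMeasure ((μ : Measure (ℕ → Fin N)).map (shift N)) :=
      Measure.isProbabilityMeasure_map measurable_shift.aemeasurable
    refine measure_ext_of_cyl fun l => ?_
    rw [map_measureReal_apply measurable_shift (measurableSet_cyl l)]
    have h1 := hreal _ ((isClopen_cyl l).preimage continuous_shift)
    have h2 := hreal _ (isClopen_cyl l)
    have h3 := h1.sub h2
    have h4 : Tendsto (fun n : ℕ => (n + 1 : ℝ)⁻¹) F (𝓝 0) := by
      have := (tendsto_one_div_add_atTop_nhds_zero_nat (𝕜 := ℝ)).mono_left hF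
      simpa using this
    have h5 : Tendsto (fun n => (shiftAverage (ν n) n).real (shift N ⁻¹' cyl l) -
        (shiftAverage (ν n) n).real (cyl l)) F (𝓝 0) := by
      refine squeeze_zero_norm (fun n => ?_) h4
      rw [shiftAverage_real _ _ (measurable_shift (measurableSet_cyl l)),
        shiftAverage_real _ _ (measurableSet_cyl l), ← mul_sub, ← Finset.sum_sub_distrib]
      have : ∀ q, (ν n).real ((shift N)^[q] ⁻¹' (shift N ⁻¹' cyl l)) =
          (ν n).real ((shift N)^[q + 1] ⁻¹' cyl l) := by
        intro q
        rw [Function.iterate_succ', Set.preimage_comp]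
      simp only [this]
      rw [Finset.sum_range_sub (fun q => (ν n).real ((shift N)^[q] ⁻¹' cyl l)), norm_mul,
        Real.norm_of_nonneg (by positivity : (0 : ℝ) ≤ (n + 1 : ℝ)⁻¹)]
      refine mul_le_of_le_one_right (by positivity) ?_
      rw [Real.norm_eq_abs, abs_sub_le_iff]
      constructor <;>
      · have ha := measureReal_le_one (μ := ν n) (s := (shift N)^[n + 1] ⁻¹' cyl l)
        have hb := measureReal_le_one (μ := ν n) (s := (shift N)^[0] ⁻¹' cyl l)
        have hc := measureReal_nonneg (μ := ν n) (s := (shift N)^[n + 1] ⁻¹' cyl l)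
        have hd := measureReal_nonneg (μ := ν n) (s := (shift N)^[0] ⁻¹' cyl l)
        linarith
    exact sub_eq_zero.1 (tendsto_nhds_unique h3 h5)
  · intro l c C n₀ H
    have h2 := hreal _ (isClopen_cyl l)
    have hev : ∀ᶠ n in (F : Filter ℕ), c ≤ (shiftAverage (ν n) n).real (cyl l) ∧
        (shiftAverage (ν n) n).real (cyl l) ≤ C := by
      filter_upwards [hF (eventually_ge_atTop n₀)] with n hn
      rw [shiftAverage_real _ _ (measurableSet_cyl l), ← div_eq_inv_mul]
      have hpos : (0 : ℝ) < n + 1 := by positivity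
      constructor
      · rw [le_div_iff₀ hpos]
        have := Finset.card_nsmul_le_sum (Finset.range (n + 1))
          (fun q => (ν n).real ((shift N)^[q] ⁻¹' cyl l)) c
          fun q hq => (H n hn q (by simpa [Nat.lt_succ_iff] using hq)).1
        simpa [mul_comm] using this
      · rw [div_le_iff₀ hpos]
        have := Finset.sum_le_card_nsmul (Finset.range (n + 1))
          (fun q => (ν n).real ((shift N)^[q] ⁻¹' cyl l)) C
          fun q hq => (H n hn q (by simpa [Nat.lt_succ_iff] using hq)).2
        simpa [mul_comm] using this
    exact ⟨ge_of_tendsto h2 (hev.mono fun _ h => h.1), le_of_tendsto h2 (hev.mono fun _ h => h.2)⟩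

/-- Any probability vector on words of length `n` is realised on cylinders. -/
lemma exists_measure_of_wordSum_eq_one [NeZero N] {n : ℕ} {w : Word N → ℝ} (hw : ∀ l, 0 ≤ w l)
    (h1 : wordSum n w = 1) :
    ∃ ν : Measure (ℕ → Fin N), IsProbabilityMeasure ν ∧
      ∀ l : Word N, l.length = n → ν.real (cyl l) = w l := by
  let e : (Fin n → Fin N) → ℕ → Fin N := fun f k => (List.ofFn f).getD k 0
  have he : ∀ f (l : Word N), l.length = n → (e f ∈ cyl l ↔ List.ofFn f = l) := by
    intro f l hl
    rw [mem_cyl_iff_of_length hl]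
    have : seqPrefix n (e f) = List.ofFn f := by
      unfold seqPrefix
      congr 1
      ext i
      simp [e]
    rw [this]
  let ν : Measure (ℕ → Fin N) := ∑ f : Fin n → Fin N,
    ENNReal.ofReal (w (List.ofFn f)) • Measure.dirac (e f)
  have hν : IsProbabilityMeasure ν := by
    constructor
    simp only [ν, Measure.finsetSum_apply, Measure.smul_apply, measure_univ, smul_eq_mul, mul_one]
    rw [← ENNReal.ofReal_sum_of_nonneg fun f _ => hw _]
    simpa [wordSum] using h1
  refine ⟨ν, hν, fun l hl => ?_⟩
  have hd : ∀ f, (Measure.dirac (e f)) (cyl l) = if List.ofFn f = l then 1 else 0 := by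
    intro f
    rw [Measure.dirac_apply' _ (measurableSet_cyl l)]
    by_cases hf : List.ofFn f = l
    · rw [Set.indicator_of_mem ((he f l hl).2 hf), if_pos hf, Pi.one_apply]
    · rw [Set.indicator_of_notMem (fun hm => hf ((he f l hl).1 hm)), if_neg hf]
  have : ν (cyl l) = ENNReal.ofReal (wordSum l.length fun a => if a = l then w a else 0) := by
    subst hl
    unfold wordSum
    rw [ENNReal.ofReal_sum_of_nonneg fun f _ => by
      dsimp only; split_ifs <;> simp [hw]]
    simp only [ν, Measure.finsetSum_apply, Measure.smul_apply, hd, smul_eq_mul]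
    refine Finset.sum_congr rfl fun f _ => ?_
    split_ifs <;> simp
  rw [wordSum_ite_eq] at this
  rw [Measure.real, this, ENNReal.toReal_ofReal (hw l)]

variable {Φ : Word N → ℝ}

lemma Quasimult.exists_wordSum_bounds [NeZero N] (hq : Quasimult Φ) (h : IsPotential Φ) :
    ∃ D : ℝ, 0 < D ∧ ∀ (l : Word N) (s : ℕ),
      Φ l * wordSum s Φ ≤ D * wordSum s (fun b => Φ (l ++ b)) ∧
      wordSum s Φ * Φ l ≤ D * wordSum s (fun a => Φ (a ++ l)) := by
  obtain ⟨δ, hδ, F, hF⟩ := hq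
  have hpos := h.pos
  have hF0 : F.Nonempty := by
    obtain ⟨j, hj, -⟩ := hF [] []
    exact ⟨j, hj⟩
  set K : ℝ := ∑ j ∈ F, wordSum j.length Φ with hK
  have hK0 : 0 < K := Finset.sum_pos (fun j _ => h.wordSum_pos _) hF0
  have key : ∀ x y, δ * (Φ x * Φ y) ≤ ∑ j ∈ F, Φ (x ++ j ++ y) := by
    intro x y
    obtain ⟨j, hj, hle⟩ := hF x y
    exact hle.trans (Finset.single_le_sum (f := fun j => Φ (x ++ j ++ y))
      (fun j _ => (hpos _).le) hj)
  have hR : ∀ (l : Word N) (s : ℕ) (j : Word N),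
      wordSum s (fun b => Φ (l ++ j ++ b)) ≤
        wordSum j.length Φ * wordSum s (fun b => Φ (l ++ b)) := by
    intro l s j
    calc wordSum s (fun b => Φ (l ++ j ++ b))
        = wordSum s (fun b => Φ (l ++ (j ++ b))) := by simp [List.append_assoc]
      _ ≤ wordSum j.length fun a => wordSum s fun b => Φ (l ++ (a ++ b)) :=
          le_wordSum (g := fun a => wordSum s fun b => Φ (l ++ (a ++ b)))
            fun a _ => wordSum_nonneg fun b _ => (hpos _).le
      _ = wordSum (s + j.length) fun c => Φ (l ++ c) := by rw [add_comm, wordSum_add]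
      _ = wordSum s fun b => wordSum j.length fun a => Φ (l ++ (b ++ a)) := wordSum_add _ _ _
      _ ≤ wordSum s fun b => Φ (l ++ b) * wordSum j.length Φ := by
          refine wordSum_le fun b _ => ?_
          rw [← wordSum_mul_left]
          refine wordSum_le fun a _ => ?_
          rw [← List.append_assoc]
          exact h.submult _ _
      _ = _ := by rw [wordSum_mul_right, mul_comm]
  have hL : ∀ (l : Word N) (s : ℕ) (j : Word N),
      wordSum s (fun a => Φ (a ++ j ++ l)) ≤
        wordSum j.length Φ * wordSum s (fun a => Φ (a ++ l)) := by
    intro l s j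
    calc wordSum s (fun a => Φ (a ++ j ++ l))
        ≤ wordSum s fun a => wordSum j.length fun b => Φ (a ++ b ++ l) :=
          wordSum_le fun a _ => le_wordSum (g := fun b => Φ (a ++ b ++ l)) fun b _ => (hpos _).le
      _ = wordSum (j.length + s) fun c => Φ (c ++ l) := by rw [add_comm, wordSum_add]
      _ = wordSum j.length fun b => wordSum s fun a => Φ (b ++ a ++ l) := wordSum_add _ _ _
      _ ≤ wordSum j.length fun b => Φ b * wordSum s fun a => Φ (a ++ l) := by
          refine wordSum_le fun b _ => ?_
          rw [← wordSum_mul_left]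
          refine wordSum_le fun a _ => ?_
          rw [List.append_assoc]
          exact h.submult _ _
      _ = _ := by rw [wordSum_mul_right]
  refine ⟨K / δ, by positivity, fun l s => ⟨?_, ?_⟩⟩
  · rw [div_mul_eq_mul_div, le_div_iff₀ hδ, mul_comm]
    calc δ * (Φ l * wordSum s Φ) = wordSum s fun b => δ * (Φ l * Φ b) := by
          rw [wordSum_mul_left, wordSum_mul_left]
      _ ≤ wordSum s fun b => ∑ j ∈ F, Φ (l ++ j ++ b) := wordSum_le fun b _ => key l b
      _ = ∑ j ∈ F, wordSum s fun b => Φ (l ++ j ++ b) := wordSum_finset_sum _ _ _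
      _ ≤ ∑ j ∈ F, wordSum j.length Φ * wordSum s (fun b => Φ (l ++ b)) :=
          Finset.sum_le_sum fun j _ => hR l s j
      _ = _ := by rw [← Finset.sum_mul]
  · rw [div_mul_eq_mul_div, le_div_iff₀ hδ, mul_comm]
    calc δ * (wordSum s Φ * Φ l) = wordSum s fun b => δ * (Φ b * Φ l) := by
          rw [wordSum_mul_left, wordSum_mul_right]
      _ ≤ wordSum s fun b => ∑ j ∈ F, Φ (b ++ j ++ l) := wordSum_le fun b _ => key b l
      _ = ∑ j ∈ F, wordSum s fun b => Φ (b ++ j ++ l) := wordSum_finset_sum _ _ _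
      _ ≤ ∑ j ∈ F, wordSum j.length Φ * wordSum s (fun b => Φ (b ++ l)) :=
          Finset.sum_le_sum fun j _ => hL l s j
      _ = _ := by rw [← Finset.sum_mul]

/-- A quasimultiplicative potential has an invariant Gibbs measure. -/
theorem Quasimult.exists_gibbs [NeZero N] (hq : Quasimult Φ) (h : IsPotential Φ) :
    ∃ μ : Measure (ℕ → Fin N), IsInvProb μ ∧ ∃ C : ℝ, GibbsWith Φ μ C := by
  obtain ⟨D, hD, hbd⟩ := hq.exists_wordSum_bounds h
  have hpos := h.pos
  have hZ := h.wordSum_pos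
  have hmul : ∀ n m, wordSum n Φ * wordSum m Φ ≤ D * wordSum (n + m) Φ := by
    intro n m
    rw [wordSum_add, ← wordSum_mul_right, ← wordSum_mul_left]
    exact wordSum_le fun a _ => (hbd a m).1
  have hup := h.wordSum_le_exp_pressure hD hmul
  have hlo := h.exp_pressure_le
  -- two-sided bounds for sums over words with a prescribed middle block
  have hT : ∀ (l : Word N) (q s : ℕ),
      wordSum q (fun a => wordSum s fun b => Φ (a ++ l ++ b)) ≤
        wordSum q Φ * Φ l * wordSum s Φ ∧
      wordSum q Φ * Φ l * wordSum s Φ ≤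
        D ^ 2 * wordSum q (fun a => wordSum s fun b => Φ (a ++ l ++ b)) := by
    intro l q s
    constructor
    · rw [← wordSum_mul_right, ← wordSum_mul_right]
      refine wordSum_le fun a _ => ?_
      rw [← wordSum_mul_left]
      refine wordSum_le fun b _ => ?_
      exact (h.submult _ _).trans (mul_le_mul_of_nonneg_right (h.submult _ _) (hpos _).le)
    · calc wordSum q Φ * Φ l * wordSum s Φ
          ≤ D * wordSum q (fun a => Φ (a ++ l)) * wordSum s Φ :=
            mul_le_mul_of_nonneg_right (hbd l q).2 (hZ s).le
        _ = D * wordSum q (fun a => Φ (a ++ l) * wordSum s Φ) := by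
            rw [wordSum_mul_right, mul_assoc]
        _ ≤ D * wordSum q (fun a => D * wordSum s fun b => Φ (a ++ l ++ b)) := by
            refine mul_le_mul_of_nonneg_left (wordSum_le fun a _ => (hbd (a ++ l) s).1) hD.le
        _ = _ := by rw [wordSum_mul_left]; ring
  have hex : ∀ n : ℕ, ∃ ν : Measure (ℕ → Fin N), IsProbabilityMeasure ν ∧
      ∀ l : Word N, l.length = n + n → ν.real (cyl l) = Φ l / wordSum (n + n) Φ := by
    intro n
    refine exists_measure_of_wordSum_eq_one (fun l => div_nonneg (hpos _).le (hZ _).le) ?_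
    rw [wordSum_div, div_self (hZ _).ne']
  choose ν hνp hν using hex
  obtain ⟨μ, hμ, hb⟩ := exists_isInvProb_of_bounds ν
  set P := pressure Φ with hP
  refine ⟨μ, hμ, D ^ 3 + D ^ 2, by positivity, fun l => ?_⟩
  have hlexp : 0 < Real.exp (l.length * P) := Real.exp_pos _
  have hbnd := hb l (Φ l / (D ^ 3 * Real.exp (l.length * P)))
    (D ^ 2 * Φ l / Real.exp (l.length * P)) l.length (by
      intro n hn q hqn
      have hval : (ν n).real ((shift N)^[q] ⁻¹' cyl l) =
          wordSum q (fun a => wordSum (n + n - q - l.length) fun b => Φ (a ++ l ++ b)) /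
            wordSum (n + n) Φ := by
        rw [measureReal_eq_wordSum (ν n) (measurable_shift.iterate q (measurableSet_cyl l)) q,
          ← wordSum_div]
        refine wordSum_congr fun a ha => ?_
        have : (shift N)^[q] ⁻¹' cyl l ∩ cyl a = cyl (a ++ l) := by
          rw [cyl_append, ha, Set.inter_comm]
        rw [this, measureReal_cyl_append_right _ _ (n + n - q - l.length), ← wordSum_div]
        refine wordSum_congr fun b hb => hν n _ ?_
        simp only [List.length_append]
        omega
      rw [hval]
      set s := n + n - q - l.length with hs
      have hns : ((n + n : ℕ) : ℝ) = q + l.length + s := by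
        have : n + n = q + l.length + s := by omega
        rw [this]; push_cast; ring
      have hE : Real.exp (((n + n : ℕ) : ℝ) * P) =
          Real.exp (q * P) * Real.exp (l.length * P) * Real.exp (s * P) := by
        rw [hns, ← Real.exp_add, ← Real.exp_add]; ring_nf
      have h1 := hT l q s
      have hZn := hup (n + n)
      have hZn' := hlo (n + n)
      rw [hE] at hZn hZn'
      have eq0 := Real.exp_pos (q * P)
      have es0 := Real.exp_pos (s * P)
      constructor
      · rw [div_le_div_iff₀ (by positivity) (hZ _)]
        calc Φ l * wordSum (n + n) Φ
            ≤ Φ l * (D * (Real.exp (q * P) * Real.exp (l.length * P) * Real.exp (s * P))) :=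
              mul_le_mul_of_nonneg_left hZn (hpos _).le
          _ = (Real.exp (q * P) * Φ l * Real.exp (s * P)) * (D * Real.exp (l.length * P)) := by
              ring
          _ ≤ (wordSum q Φ * Φ l * wordSum s Φ) * (D * Real.exp (l.length * P)) := by
              have := hpos l
              have a1 := hlo q
              have a2 := hlo s
              have a3 := hZ q
              gcongr
          _ ≤ (D ^ 2 * wordSum q (fun a => wordSum s fun b => Φ (a ++ l ++ b))) *
                (D * Real.exp (l.length * P)) := by
              refine mul_le_mul_of_nonneg_right h1.2 (by positivity)
          _ = _ := by ring
      · rw [div_le_div_iff₀ (hZ _) hlexp]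
        calc wordSum q (fun a => wordSum s fun b => Φ (a ++ l ++ b)) * Real.exp (l.length * P)
            ≤ (wordSum q Φ * Φ l * wordSum s Φ) * Real.exp (l.length * P) :=
              mul_le_mul_of_nonneg_right h1.1 hlexp.le
          _ ≤ ((D * Real.exp (q * P)) * Φ l * (D * Real.exp (s * P))) *
                Real.exp (l.length * P) := by
              have := hpos l
              have a1 := hup q
              have a2 := hup s
              have a3 := hZ s
              gcongr
          _ = D ^ 2 * Φ l *
                (Real.exp (q * P) * Real.exp (l.length * P) * Real.exp (s * P)) := by ring
          _ ≤ D ^ 2 * Φ l * wordSum (n + n) Φ := by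
              have := hpos l
              gcongr)
  have hl := hpos l
  constructor
  · refine le_trans ?_ (mul_le_mul_of_nonneg_right hbnd.1 hlexp.le)
    rw [div_mul_eq_mul_div, mul_div_mul_right _ _ hlexp.ne', inv_mul_eq_div]
    exact div_le_div_of_nonneg_left hl.le (by positivity) (by nlinarith [pow_pos hD 2])
  · refine (mul_le_mul_of_nonneg_right hbnd.2 hlexp.le).trans ?_
    rw [div_mul_cancel₀ _ hlexp.ne']
    exact mul_le_mul_of_nonneg_right (by nlinarith [pow_pos hD 3]) hl.le

end GibbsExistence

section Domination
variable {N : ℕ}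

lemma Ergodic.eq_of_not_mutuallySingular {X : Type*} [MeasurableSpace X] {f : X → X}
    {μ ν : Measure X} [IsProbabilityMeasure μ] [IsProbabilityMeasure ν] (hμ : Ergodic f μ)
    (hν : Ergodic f ν) (h : ¬ ν ⟂ₘ μ) : ν = μ := by
  have hρ := MeasurePreserving.withDensity_rnDeriv hν.toMeasurePreserving hμ.toMeasurePreserving
  have hle := Measure.withDensity_rnDeriv_le ν μ
  have : IsFiniteMeasure (μ.withDensity (ν.rnDeriv μ)) := isFiniteMeasure_of_le ν hle
  obtain ⟨c, hc⟩ := hν.eq_smul_of_absolutelyContinuous hρ hle.absolutelyContinuous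
  have hne : μ.withDensity (ν.rnDeriv μ) ≠ 0 := by
    rw [Ne, withDensity_eq_zero_iff (Measure.measurable_rnDeriv ν μ).aemeasurable,
      Measure.rnDeriv_eq_zero]
    exact h
  have hc0 : c ≠ 0 := by
    rintro rfl
    exact hne (by rw [hc, zero_smul])
  refine hμ.eq_of_absolutelyContinuous hν.toMeasurePreserving ?_
  refine Measure.AbsolutelyContinuous.trans ?_ (withDensity_absolutelyContinuous μ (ν.rnDeriv μ))
  rw [hc]
  exact Measure.absolutelyContinuous_smul hc0

/-- An ergodic probability measure dominated by a countable sum of ergodic probability measures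
is one of them. -/
lemma Ergodic.exists_eq_of_absolutelyContinuous_sum {X ι : Type*} [MeasurableSpace X] [Countable ι]
    {f : X → X} {μ : ι → Measure X} {ν : Measure X} [∀ i, IsProbabilityMeasure (μ i)]
    [IsProbabilityMeasure ν] (hμ : ∀ i, Ergodic f (μ i)) (hν : Ergodic f ν)
    (h : ν ≪ Measure.sum μ) : ∃ i, ν = μ i := by
  by_contra! hne
  have hs : ∀ i, ν ⟂ₘ μ i := fun i => by
    by_contra hi
    exact hne i ((hμ i).eq_of_not_mutuallySingular hν hi)
  have hνν : ν ⟂ₘ ν := (Measure.MutuallySingular.sum_right.2 hs).mono_ac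
    Measure.AbsolutelyContinuous.rfl h
  rw [Measure.MutuallySingular.self_iff] at hνν
  exact IsProbabilityMeasure.ne_zero ν hνν

/-- A nonempty open subset of the shift space contains a cylinder. -/
lemma exists_cyl_subset {U : Set (ℕ → Fin N)} (hU : IsOpen U) (hne : U.Nonempty) :
    ∃ l : Word N, cyl l ⊆ U := by
  obtain ⟨x, hx⟩ := hne
  obtain ⟨s, ⟨y, n, rfl⟩, hxs, hs⟩ :=
    (PiNat.isTopologicalBasis_cylinders fun _ : ℕ => Fin N).exists_subset_of_mem_open hx hU
  refine ⟨seqPrefix n y, fun z hz => hs ?_⟩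
  rw [mem_cyl_iff_of_length (length_seqPrefix n y)] at hz
  rw [PiNat.mem_cylinder_iff]
  intro i hi
  exact congrFun (List.ofFn_injective hz) ⟨i, hi⟩

/-- An invariant measure dominated by a sum of ergodic fully supported measures is fully
supported. -/
lemma IsInvProb.fullySupported_of_absolutelyContinuous_sum {ι : Type*} [Countable ι]
    {μ : ι → Measure (ℕ → Fin N)} {ν : Measure (ℕ → Fin N)} [∀ i, IsProbabilityMeasure (μ i)]
    (hμ : ∀ i, Ergodic (shift N) (μ i)) (hμs : ∀ i, FullySupported (μ i)) (hν : IsInvProb ν)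
    (h : ν ≪ Measure.sum μ) : FullySupported ν := by
  have := hν.1
  intro U hU hne
  rw [pos_iff_ne_zero]
  intro h0
  set G : Set (ℕ → Fin N) := ⋃ n, (shift N)^[n] ⁻¹' U with hG
  have hGm : MeasurableSet G :=
    MeasurableSet.iUnion fun n => measurable_shift.iterate n hU.measurableSet
  have hG0 : ν G = 0 := by
    rw [hG, measure_iUnion_null_iff]
    intro n
    rw [(hν.measurePreserving.iterate n).measure_preimage hU.measurableSet.nullMeasurableSet, h0]
  have hUG : U ⊆ G := by
    intro x hx
    exact Set.mem_iUnion.2 ⟨0, hx⟩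
  have hsub : shift N ⁻¹' G ⊆ G := by
    intro x hx
    obtain ⟨n, hn⟩ := Set.mem_iUnion.1 (Set.mem_preimage.1 hx)
    refine Set.mem_iUnion.2 ⟨n + 1, ?_⟩
    rw [Set.mem_preimage, Function.iterate_succ_apply]
    exact hn
  have hGc : ∀ i, (μ i) Gᶜ = 0 := by
    intro i
    rcases (hμ i).ae_empty_or_univ_of_preimage_ae_le hGm.nullMeasurableSet
      (LE.le.eventuallyLE hsub) with h1 | h1
    · exfalso
      have h2 := measure_congr h1
      rw [measure_empty] at h2
      exact (hμs i U hU hne).ne' (measure_mono_null hUG h2)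
    · exact ae_eq_univ.1 h1
  have hνc : ν Gᶜ = 0 := by
    apply h
    rw [Measure.sum_apply _ hGm.compl]
    simp [hGc]
  have h1 : ν Set.univ = 0 := by
    rw [← Set.union_compl_self G]
    exact measure_union_null hG0 hνc
  simp at h1

end Domination

section EquilibriumStates
variable {N : ℕ} [NeZero N] {Φ : Word N → ℝ}

omit [NeZero N] in
lemma GibbsWith.fullySupported {μ : Measure (ℕ → Fin N)} (h : IsPotential Φ) {C : ℝ}
    (hC : GibbsWith Φ μ C) : FullySupported μ := by
  intro U hU hne
  obtain ⟨l, hl⟩ := exists_cyl_subset hU hne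
  refine lt_of_lt_of_le ?_ (measure_mono hl)
  rw [pos_iff_ne_zero]
  intro h0
  have := (hC.2 l).1
  rw [h0, ENNReal.toReal_zero, zero_mul] at this
  exact absurd this (not_le.2 (mul_pos (inv_pos.2 hC.1) (h.pos l)))

/-- A quasimultiplicative potential has a unique equilibrium state, and it is an ergodic Gibbs
measure. -/
theorem Quasimult.exists_unique_eqState (hq : Quasimult Φ) (h : IsPotential Φ) :
    ∃ μ : Measure (ℕ → Fin N), IsEqState Φ μ ∧ (∀ ν, IsEqState Φ ν → ν = μ) ∧
      Ergodic (shift N) μ ∧ ∃ C : ℝ, GibbsWith Φ μ C := by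
  obtain ⟨μ, hμ, C, hC⟩ := hq.exists_gibbs h
  have := hμ.1
  have herg := GibbsWith.ergodic hμ h hq hC
  refine ⟨μ, GibbsWith.isEqState hμ h hC, fun ν hν => ?_, herg, C, hC⟩
  have := hν.1.1
  exact herg.eq_of_absolutelyContinuous hν.1.measurePreserving
    (hν.absolutelyContinuous h (inv_pos.2 hC.1) fun l => (hC.2 l).1)

/-- If `Φ` is comparable to the maximum of finitely many dominated potentials having Gibbs
measures, its equilibrium states are dominated by the sum of these measures. -/
lemma IsEqState.absolutelyContinuous_sum {ι : Type*} [Finite ι] {Ψ : ι → Word N → ℝ}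
    {μ : ι → Measure (ℕ → Fin N)} (hΦ : IsPotential Φ) (hΨ : ∀ j, IsPotential (Ψ j))
    (hμ : ∀ j, ∃ C : ℝ, GibbsWith (Ψ j) (μ j) C) (hμp : ∀ j, IsProbabilityMeasure (μ j))
    {τ : ℝ} (hτ : 0 < τ) (hlow : ∀ l, ∃ j, τ * Φ l ≤ Ψ j l) (hup : ∀ j l, Ψ j l ≤ Φ l)
    {ν : Measure (ℕ → Fin N)} (hν : IsEqState Φ ν) : ν ≪ Measure.sum μ := by
  have := Fintype.ofFinite ι
  choose C hC using hμ
  obtain ⟨j₀, -⟩ := hlow []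
  have hne : (Finset.univ : Finset ι).Nonempty := ⟨j₀, Finset.mem_univ _⟩
  set c := Finset.univ.inf' hne fun j => (C j)⁻¹ with hc
  have hc0 : 0 < c := by
    rw [hc, Finset.lt_inf'_iff]
    exact fun j _ => inv_pos.2 (hC j).1
  have hfin : IsFiniteMeasure (Measure.sum μ) := by
    rw [Measure.sum_fintype]
    infer_instance
  refine hν.absolutelyContinuous hΦ (mul_pos hc0 hτ) fun l => ?_
  obtain ⟨j, hj⟩ := hlow l
  calc c * τ * Φ l ≤ (C j)⁻¹ * Ψ j l := by
        rw [mul_assoc]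
        exact mul_le_mul (Finset.inf'_le _ (Finset.mem_univ j)) hj
          (mul_nonneg hτ.le (hΦ.pos l).le) (inv_pos.2 (hC j).1).le
    _ ≤ (μ j).real (cyl l) * Real.exp (l.length * pressure (Ψ j)) := ((hC j).2 l).1
    _ ≤ (Measure.sum μ).real (cyl l) * Real.exp (l.length * pressure Φ) := by
        have h1 : (μ j).real (cyl l) ≤ (Measure.sum μ).real (cyl l) :=
          ENNReal.toReal_mono (measure_ne_top _ _) (Measure.le_sum μ j _)
        have h2 := (hΨ j).pressure_mono hΦ (hup j)
        have h3 := measureReal_nonneg (μ := μ j) (s := cyl l)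
        gcongr

end EquilibriumStates

section WordAction
variable {N : ℕ}

lemma wordProd_append {M : Type*} [Monoid M] (A : Fin N → M) (l m : Word N) :
    wordProd A (l ++ m) = wordProd A m * wordProd A l := by
  simp [wordProd]

lemma wordProd_singleton {M : Type*} [Monoid M] (A : Fin N → M) (j : Fin N) :
    wordProd A [j] = A j := by
  simp [wordProd]

lemma isUnit_wordProd {M : Type*} [Monoid M] {A : Fin N → M} (hA : ∀ j, IsUnit (A j))
    (l : Word N) : IsUnit (wordProd A l) := by
  induction l with
  | nil => simp [wordProd]
  | cons a l ih =>
    rw [← List.singleton_append, wordProd_append, wordProd_singleton]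
    exact ih.mul (hA a)

/-- If words act by injective maps and the orbit of `x` is finite, then one can return to `x` from
every point of the orbit. -/
lemma exists_word_return {X : Type*} (act : Word N → X → X) (hnil : ∀ x, act [] x = x)
    (happ : ∀ l m x, act (l ++ m) x = act m (act l x)) (hinj : ∀ l, Function.Injective (act l))
    {x : X} (hfin : {y | ∃ l, y = act l x}.Finite) (l : Word N) : ∃ c, act c (act l x) = x := by
  have hpow : ∀ n : ℕ, ∃ c, ∀ y, (act l)^[n] y = act c y := by
    intro n
    induction n with
    | zero => exact ⟨[], fun y => (hnil y).symm⟩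
    | succ n ih =>
      obtain ⟨c, hc⟩ := ih
      exact ⟨l ++ c, fun y => by rw [Function.iterate_succ_apply, hc, happ]⟩
  obtain ⟨m, n, hmn, heq⟩ : ∃ m n : ℕ, m < n ∧ (act l)^[m] x = (act l)^[n] x := by
    have : ∀ n : ℕ, (act l)^[n] x ∈ {y | ∃ l, y = act l x} := fun n => by
      obtain ⟨c, hc⟩ := hpow n
      exact ⟨c, hc x⟩
    exact hfin.exists_lt_map_eq_of_forall_mem this
  obtain ⟨d, rfl⟩ := Nat.exists_eq_add_of_lt hmn
  rw [show m + d + 1 = m + (d + 1) by ring, Function.iterate_add_apply] at heq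
  have h := (hinj l).iterate m heq
  obtain ⟨c, hc⟩ := hpow d
  rw [Function.iterate_succ_apply] at h
  exact ⟨c, by rw [← hc, ← h]⟩

end WordAction

section Orbit
variable {N : ℕ} {V : Type*} [NormedAddCommGroup V] [InnerProductSpace ℝ V]

lemma wordProd_injective {B : Fin N → V →L[ℝ] V} (hB : ∀ j, IsUnit (B j)) (l : Word N) :
    Function.Injective (wordProd B l).toLinearMap := by
  obtain ⟨u, hu⟩ := isUnit_wordProd hB l
  intro x y h
  have h' : wordProd B l x = wordProd B l y := h
  have hx : ∀ z, (u⁻¹ : (V →L[ℝ] V)ˣ).val (wordProd B l z) = z := by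
    intro z
    rw [← hu, ← mul_apply_eq_comp, Units.inv_mul, one_apply_eq_self]
  rw [← hx x, h', hx y]

lemma map_wordProd_append (B : Fin N → V →L[ℝ] V) (l m : Word N) (W : Submodule ℝ V) :
    W.map (wordProd B (l ++ m)).toLinearMap =
      (W.map (wordProd B l).toLinearMap).map (wordProd B m).toLinearMap := by
  rw [wordProd_append, ← Submodule.map_comp]
  rfl

lemma map_wordProd_nil (B : Fin N → V →L[ℝ] V) (W : Submodule ℝ V) :
    W.map (wordProd B []).toLinearMap = W := by
  have : (wordProd B []).toLinearMap = LinearMap.id := by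
    ext x; simp [wordProd]
  rw [this, Submodule.map_id]

/-- The orbit of a subspace under all word products. -/
def subspaceOrbit (B : Fin N → V →L[ℝ] V) (U : Submodule ℝ V) : Set (Submodule ℝ V) :=
  {W | ∃ l : Word N, W = U.map (wordProd B l).toLinearMap}

lemma self_mem_subspaceOrbit (B : Fin N → V →L[ℝ] V) (U : Submodule ℝ V) :
    U ∈ subspaceOrbit B U := ⟨[], (map_wordProd_nil B U).symm⟩

lemma map_mem_subspaceOrbit {B : Fin N → V →L[ℝ] V} {U W : Submodule ℝ V}
    (hW : W ∈ subspaceOrbit B U) (l : Word N) :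
    W.map (wordProd B l).toLinearMap ∈ subspaceOrbit B U := by
  obtain ⟨m, rfl⟩ := hW
  exact ⟨m ++ l, (map_wordProd_append B m l U).symm⟩

lemma subspaceOrbit_subset {B : Fin N → V →L[ℝ] V} {U W : Submodule ℝ V}
    (hW : W ∈ subspaceOrbit B U) : subspaceOrbit B W ⊆ subspaceOrbit B U := by
  rintro _ ⟨l, rfl⟩
  exact map_mem_subspaceOrbit hW l

lemma finite_subspaceOrbit_inf {B : Fin N → V →L[ℝ] V} (hB : ∀ j, IsUnit (B j))
    {U W : Submodule ℝ V} (hU : (subspaceOrbit B U).Finite) (hW : (subspaceOrbit B W).Finite) :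
    (subspaceOrbit B (U ⊓ W)).Finite := by
  refine (hU.image2 (· ⊓ ·) hW).subset ?_
  rintro _ ⟨l, rfl⟩
  exact ⟨_, ⟨l, rfl⟩, _, ⟨l, rfl⟩, (Submodule.map_inf _ (wordProd_injective hB l)).symm⟩

lemma finite_subspaceOrbit_sup {B : Fin N → V →L[ℝ] V}
    {U W : Submodule ℝ V} (hU : (subspaceOrbit B U).Finite) (hW : (subspaceOrbit B W).Finite) :
    (subspaceOrbit B (U ⊔ W)).Finite := by
  refine (hU.image2 (· ⊔ ·) hW).subset ?_
  rintro _ ⟨l, rfl⟩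
  exact ⟨_, ⟨l, rfl⟩, _, ⟨l, rfl⟩, (Submodule.map_sup _ _ _).symm⟩

lemma finrank_map_wordProd {B : Fin N → V →L[ℝ] V} (hB : ∀ j, IsUnit (B j)) (l : Word N)
    (W : Submodule ℝ V) :
    Module.finrank ℝ (W.map (wordProd B l).toLinearMap) = Module.finrank ℝ W :=
  (LinearEquiv.finrank_eq (Submodule.equivMapOfInjective _ (wordProd_injective hB l) W)).symm

lemma finrank_of_mem_subspaceOrbit {B : Fin N → V →L[ℝ] V} (hB : ∀ j, IsUnit (B j))
    {U W : Submodule ℝ V} (hW : W ∈ subspaceOrbit B U) :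
    Module.finrank ℝ W = Module.finrank ℝ U := by
  obtain ⟨l, rfl⟩ := hW
  exact finrank_map_wordProd hB l U

variable [FiniteDimensional ℝ V]

lemma sSup_subspaceOrbit {B : Fin N → V →L[ℝ] V} (hB : ∀ j, IsUnit (B j))
    (hirr : IrreducibleTuple fun j => (B j : V →ₗ[ℝ] V)) {U : Submodule ℝ V} (hU : U ≠ ⊥) :
    sSup (subspaceOrbit B U) = ⊤ := by
  refine (hirr (sSup (subspaceOrbit B U)) fun j => ?_).resolve_left fun h => hU ?_
  · have hj : (B j : V →ₗ[ℝ] V) = (wordProd B [j]).toLinearMap := by rw [wordProd_singleton]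
    beta_reduce
    rw [hj]
    refine Submodule.eq_of_le_of_finrank_eq ?_ (finrank_map_wordProd hB _ _)
    rw [Submodule.map_le_iff_le_comap, sSup_le_iff]
    intro W hW
    rw [← Submodule.map_le_iff_le_comap]
    exact le_sSup (map_mem_subspaceOrbit hW [j])
  · rw [eq_bot_iff, ← h]
    exact le_sSup (self_mem_subspaceOrbit B U)

/-- For an irreducible tuple, finitely many members of a finite orbit of subspaces of minimal
dimension decompose the whole space. -/
lemma exists_orbit_decomposition {B : Fin N → V →L[ℝ] V} (hB : ∀ j, IsUnit (B j))
    (hirr : IrreducibleTuple fun j => (B j : V →ₗ[ℝ] V)) {U : Submodule ℝ V} (hU : U ≠ ⊥)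
    (hfin : (subspaceOrbit B U).Finite)
    (hmin : ∀ W : Submodule ℝ V, W ≠ ⊥ → (subspaceOrbit B W).Finite →
      Module.finrank ℝ U ≤ Module.finrank ℝ W) :
    ∃ (t : ℕ) (S : Fin t → Submodule ℝ V), (∀ s, S s ∈ subspaceOrbit B U) ∧ ⨆ s, S s = ⊤ ∧
      t * Module.finrank ℝ U = Module.finrank ℝ V := by
  by_contra hcon
  push Not at hcon
  have key : ∀ n : ℕ, ∃ S : Fin n → Submodule ℝ V, (∀ s, S s ∈ subspaceOrbit B U) ∧
      (subspaceOrbit B (⨆ s, S s)).Finite ∧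
      Module.finrank ℝ (⨆ s, S s : Submodule ℝ V) = n * Module.finrank ℝ U := by
    intro n
    induction n with
    | zero =>
      refine ⟨fun s => s.elim0, fun s => s.elim0, ?_, ?_⟩
      · rw [iSup_of_empty]
        refine (Set.finite_singleton (⊥ : Submodule ℝ V)).subset ?_
        rintro _ ⟨l, rfl⟩
        simp
      · rw [iSup_of_empty]; simp
    | succ n ih =>
      obtain ⟨S, hS, hSf, hSd⟩ := ih
      have hne : (⨆ s, S s) ≠ ⊤ := by
        intro h
        refine hcon n S hS h ?_
        rw [← hSd, h, finrank_top]
      obtain ⟨W, hW, hWS⟩ : ∃ W ∈ subspaceOrbit B U, ¬ W ≤ ⨆ s, S s := by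
        by_contra! hall
        exact hne (top_le_iff.1 ((sSup_subspaceOrbit hB hirr hU).ge.trans (sSup_le hall)))
      have hWf : (subspaceOrbit B W).Finite := hfin.subset (subspaceOrbit_subset hW)
      have hWd := finrank_of_mem_subspaceOrbit hB hW
      have hinf : W ⊓ ⨆ s, S s = ⊥ := by
        by_contra h
        have h1 := hmin _ h (finite_subspaceOrbit_inf hB hWf hSf)
        have h2 := Submodule.finrank_lt_finrank_of_lt (inf_lt_left.2 hWS)
        omega
      have hsup : (⨆ s, (Fin.cons W S : Fin (n + 1) → Submodule ℝ V) s) = W ⊔ ⨆ s, S s := by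
        apply le_antisymm
        · refine iSup_le fun s => ?_
          refine Fin.cases ?_ (fun s => ?_) s
          · simp
          · rw [Fin.cons_succ]
            exact le_sup_of_le_right (le_iSup S s)
        · refine sup_le ?_ (iSup_le fun s => ?_)
          · exact le_iSup_of_le 0 (by simp)
          · exact le_iSup_of_le s.succ (by simp)
      refine ⟨Fin.cons W S, fun s => ?_, ?_, ?_⟩
      · refine Fin.cases ?_ (fun s => ?_) s
        · simpa using hW
        · simpa using hS s
      · rw [hsup]
        exact finite_subspaceOrbit_sup hWf hSf
      · have h1 := Submodule.finrank_sup_add_finrank_inf_eq W (⨆ s, S s)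
        rw [hinf, finrank_bot, hWd, hSd] at h1
        rw [hsup]
        rw [add_mul, one_mul]
        omega
  obtain ⟨S, -, -, hS⟩ := key (Module.finrank ℝ V + 1)
  have h1 := Submodule.finrank_le (⨆ s, S s)
  have h2 : 0 < Module.finrank ℝ U := by
    rw [Nat.pos_iff_ne_zero, Ne, Submodule.finrank_eq_zero]
    exact hU
  rw [hS] at h1
  nlinarith

end Orbit

section Essential
variable {K E : Type*} [Field K] [AddCommGroup E] [Module K E]

/-- A subspace `L` is essential for a set `Γ` if every finite family of subspaces covering
`L ∩ Γ` has a member containing `L`. -/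
def EssentialFor (Γ : Set E) (L : Submodule K E) : Prop :=
  ∀ 𝓢 : Set (Submodule K E), 𝓢.Finite → (∀ x ∈ Γ, x ∈ L → ∃ S ∈ 𝓢, x ∈ S) → ∃ S ∈ 𝓢, L ≤ S

variable [FiniteDimensional K E]

lemma exists_essential_cover (Γ : Set E) (L : Submodule K E) :
    ∃ 𝓢 : Set (Submodule K E), 𝓢.Finite ∧ (∀ S ∈ 𝓢, EssentialFor Γ S) ∧
      ∀ x ∈ Γ, x ∈ L → ∃ S ∈ 𝓢, x ∈ S := by
  induction L using WellFoundedLT.induction with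
  | ind L ih =>
    by_cases hL : EssentialFor Γ L
    · exact ⟨{L}, Set.finite_singleton L, by simpa using hL, fun x _ hx => ⟨L, rfl, hx⟩⟩
    · unfold EssentialFor at hL
      push Not at hL
      obtain ⟨𝓢, hfin, hcov, hlt⟩ := hL
      have : ∀ S ∈ 𝓢, ∃ 𝓣 : Set (Submodule K E), 𝓣.Finite ∧ (∀ T ∈ 𝓣, EssentialFor Γ T) ∧
          ∀ x ∈ Γ, x ∈ L ⊓ S → ∃ T ∈ 𝓣, x ∈ T := fun S hS => ih _ (inf_lt_left.2 (hlt S hS))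
      choose! 𝓣 hTf hTe hTc using this
      refine ⟨⋃ S ∈ 𝓢, 𝓣 S, hfin.biUnion hTf, ?_, ?_⟩
      · intro T hT
        simp only [Set.mem_iUnion] at hT
        obtain ⟨S, hS, hT⟩ := hT
        exact hTe S hS T hT
      · intro x hxΓ hxL
        obtain ⟨S, hS, hxS⟩ := hcov x hxΓ hxL
        obtain ⟨T, hT, hxT⟩ := hTc S hS x hxΓ ⟨hxL, hxS⟩
        exact ⟨T, by simp only [Set.mem_iUnion]; exact ⟨S, hS, hT⟩, hxT⟩

/-- There is an essential subspace all of whose images under injective linear maps preserving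
`Γ` lie in one fixed finite set. -/
lemma exists_essential_finite_images {Γ : Set E} (hΓ : Γ.Nonempty) :
    ∃ (L : Submodule K E) (𝓔 : Set (Submodule K E)), 𝓔.Finite ∧ EssentialFor Γ L ∧
      ∀ φ : E →ₗ[K] E, Function.Injective φ → (∀ x ∈ Γ, φ x ∈ Γ) → L.map φ ∈ 𝓔 := by
  obtain ⟨𝓢, hfin, hess, hcov⟩ := exists_essential_cover Γ (⊤ : Submodule K E)
  have hne : 𝓢.Nonempty := by
    obtain ⟨x, hx⟩ := hΓ
    obtain ⟨S, hS, -⟩ := hcov x hx trivial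
    exact ⟨S, hS⟩
  obtain ⟨L, hL, hmax⟩ := hfin.exists_maximalFor (fun S : Submodule K E => Module.finrank K S) 𝓢 hne
  refine ⟨L, 𝓢, hfin, hess L hL, fun φ hφ hφΓ => ?_⟩
  have hφL : EssentialFor Γ (L.map φ) := by
    intro 𝓣 h𝓣 hc
    obtain ⟨S, ⟨T, hT, rfl⟩, hLS⟩ := hess L hL ((fun T => T.comap φ) '' 𝓣) (h𝓣.image _) (by
      intro x hx hxL
      obtain ⟨T, hT, hxT⟩ := hc (φ x) (hφΓ x hx) ⟨x, hxL, rfl⟩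
      exact ⟨_, ⟨T, hT, rfl⟩, hxT⟩)
    exact ⟨T, hT, Submodule.map_le_iff_le_comap.2 hLS⟩
  obtain ⟨S, hS, hle⟩ := hφL 𝓢 hfin fun x hx _ => hcov x hx trivial
  have hdim : Module.finrank K (L.map φ) = Module.finrank K L :=
    (LinearEquiv.finrank_eq (Submodule.equivMapOfInjective φ hφ L)).symm
  have h1 := Submodule.finrank_mono hle
  have h2 : Module.finrank K S ≤ Module.finrank K L := by
    rcases le_total (Module.finrank K S) (Module.finrank K L) with h | h
    · exact h
    · exact hmax hS h
  rw [Submodule.eq_of_le_of_finrank_eq hle (by omega)]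
  exact hS

end Essential

section TupleOrbit
variable {N : ℕ} {ι : Type*} {V : ι → Type*} [∀ i, NormedAddCommGroup (V i)]
  [∀ i, InnerProductSpace ℝ (V i)]

/-- The action of a word on a tuple of subspaces. -/
def wordAct (A : ∀ i, Fin N → (V i →L[ℝ] V i)) (l : Word N) (W : ∀ i, Submodule ℝ (V i)) :
    ∀ i, Submodule ℝ (V i) :=
  fun i => (W i).map (wordProd (A i) l).toLinearMap

/-- The orbit of a tuple of subspaces. -/
def wordOrbit (A : ∀ i, Fin N → (V i →L[ℝ] V i)) (W : ∀ i, Submodule ℝ (V i)) :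
    Set (∀ i, Submodule ℝ (V i)) :=
  {Y | ∃ l, Y = wordAct A l W}

variable {A : ∀ i, Fin N → (V i →L[ℝ] V i)}

lemma wordAct_nil (W : ∀ i, Submodule ℝ (V i)) : wordAct A [] W = W :=
  funext fun i => map_wordProd_nil (A i) (W i)

lemma wordAct_append (l m : Word N) (W : ∀ i, Submodule ℝ (V i)) :
    wordAct A (l ++ m) W = wordAct A m (wordAct A l W) :=
  funext fun i => map_wordProd_append (A i) l m (W i)

lemma wordAct_injective (hA : ∀ i j, IsUnit (A i j)) (l : Word N) :
    Function.Injective (wordAct A l) := by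
  intro W Y h
  funext i
  exact Submodule.map_injective_of_injective (wordProd_injective (hA i) l) (congrFun h i)

lemma self_mem_wordOrbit (W : ∀ i, Submodule ℝ (V i)) : W ∈ wordOrbit A W :=
  ⟨[], (wordAct_nil W).symm⟩

lemma wordAct_mem_wordOrbit {W Y : ∀ i, Submodule ℝ (V i)} (hY : Y ∈ wordOrbit A W)
    (l : Word N) : wordAct A l Y ∈ wordOrbit A W := by
  obtain ⟨m, rfl⟩ := hY
  exact ⟨m ++ l, (wordAct_append m l W).symm⟩

lemma mem_subspaceOrbit_of_mem_wordOrbit {W Y : ∀ i, Submodule ℝ (V i)}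
    (hY : Y ∈ wordOrbit A W) (i : ι) : Y i ∈ subspaceOrbit (A i) (W i) := by
  obtain ⟨l, rfl⟩ := hY
  exact ⟨l, rfl⟩

lemma finite_wordOrbit [Finite ι] {W : ∀ i, Submodule ℝ (V i)}
    (h : ∀ i, (subspaceOrbit (A i) (W i)).Finite) : (wordOrbit A W).Finite :=
  (Set.Finite.pi' h).subset fun _ hY i => mem_subspaceOrbit_of_mem_wordOrbit hY i

/-- A finite orbit is transitive. -/
lemma exists_wordAct_eq (hA : ∀ i j, IsUnit (A i j)) {W Y Y' : ∀ i, Submodule ℝ (V i)}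
    (hfin : (wordOrbit A W).Finite) (hY : Y ∈ wordOrbit A W) (hY' : Y' ∈ wordOrbit A W) :
    ∃ c, wordAct A c Y = Y' := by
  obtain ⟨l, rfl⟩ := hY
  obtain ⟨m, rfl⟩ := hY'
  obtain ⟨c, hc⟩ := exists_word_return (wordAct A) wordAct_nil wordAct_append
    (wordAct_injective hA) hfin l
  exact ⟨c ++ m, by rw [wordAct_append, hc]⟩

variable [∀ i, FiniteDimensional ℝ (V i)]

/-- In a finite orbit of tuples of subspaces of minimal dimension, some word stabilising `Y`
moves given nonzero vectors out of given hyperplanes simultaneously. -/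
lemma exists_stabilizer_word [Finite ι] (hA : ∀ i j, IsUnit (A i j))
    {Y : ∀ i, Submodule ℝ (V i)} (hfin : (wordOrbit A Y).Finite)
    (hmin : ∀ i, ∀ Z : Submodule ℝ (V i), Z ≠ ⊥ → (subspaceOrbit (A i) Z).Finite →
      Module.finrank ℝ (Y i) ≤ Module.finrank ℝ Z)
    {u : ∀ i, V i} (hu : ∀ i, u i ∈ Y i) (hu0 : ∀ i, u i ≠ 0)
    {w : ∀ i, V i →ₗ[ℝ] ℝ} (hw : ∀ i, ¬ Y i ≤ LinearMap.ker (w i)) :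
    ∃ c, wordAct A c Y = Y ∧ ∀ i, w i (wordProd (A i) c (u i)) ≠ 0 := by
  classical
  by_contra hcon
  push Not at hcon
  let E := ∀ i, V i →ₗ[ℝ] V i
  let g : Word N → E := fun l i => (wordProd (A i) l).toLinearMap
  have hgapp : ∀ l m i, g (l ++ m) i = g m i ∘ₗ g l i := by
    intro l m i
    simp only [g, wordProd_append]
    rfl
  let Γ : Set E := {x | ∃ c, wordAct A c Y = Y ∧ x = g c}
  have hΓne : Γ.Nonempty := ⟨g [], [], wordAct_nil Y, rfl⟩
  obtain ⟨L, 𝓔, h𝓔, hL, hLim⟩ := exists_essential_finite_images (K := ℝ) hΓne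
  let ev : ∀ i, E →ₗ[ℝ] V i := fun i => (LinearMap.applyₗ (u i)).comp (LinearMap.proj i)
  have hev : ∀ i (x : E), ev i x = x i (u i) := fun i x => rfl
  -- a single component whose hyperplane swallows `L`
  obtain ⟨_, ⟨i, rfl⟩, hLi⟩ := hL (Set.range fun i => (LinearMap.ker (w i)).comap (ev i))
    (Set.finite_range _) (by
      rintro _ ⟨c, hc, rfl⟩ -
      obtain ⟨i, hi⟩ := hcon c hc
      exact ⟨_, ⟨i, rfl⟩, hi⟩)
  have hone : ∀ S : Submodule ℝ E, (∀ x ∈ Γ, x ∈ L → x ∈ S) → L ≤ S := by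
    intro S hS
    obtain ⟨T, rfl, hT⟩ := hL {S} (Set.finite_singleton S) fun x hx hxL => ⟨S, rfl, hS x hx hxL⟩
    exact hT
  set Z : Submodule ℝ (V i) := L.map (ev i) with hZ
  have hZker : Z ≤ LinearMap.ker (w i) := Submodule.map_le_iff_le_comap.2 hLi
  have hZY : Z ≤ Y i := by
    refine Submodule.map_le_iff_le_comap.2 (hone _ ?_)
    rintro _ ⟨c, hc, rfl⟩ -
    rw [Submodule.mem_comap, hev, ← congrFun hc i]
    exact ⟨u i, hu i, rfl⟩
  have hZ0 : Z ≠ ⊥ := by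
    intro h0
    obtain ⟨x, ⟨c, -, rfl⟩, hxL⟩ : ∃ x ∈ Γ, x ∈ L := by
      by_contra! hno
      obtain ⟨S, hS, -⟩ := hL ∅ Set.finite_empty fun x hx hxL => (hno x hx hxL).elim
      exact hS
    have hmem : g c i (u i) ∈ Z := ⟨g c, hxL, rfl⟩
    rw [h0, Submodule.mem_bot] at hmem
    exact hu0 i (wordProd_injective (hA i) c (by rw [map_zero]; exact hmem))
  have hlt : Module.finrank ℝ Z < Module.finrank ℝ (Y i) := by
    refine Submodule.finrank_lt_finrank_of_lt (lt_of_le_of_ne hZY ?_)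
    rintro heq
    exact hw i (heq ▸ hZker)
  -- the orbit of `Z` under words stabilising `Y`
  have hstab : ∀ c, wordAct A c Y = Y → Z.map (g c i) ∈ (fun L => L.map (ev i)) '' 𝓔 := by
    intro c hc
    let φ : E →ₗ[ℝ] E := LinearMap.pi fun i => (LinearMap.llcomp ℝ (V i) (V i) (V i) (g c i)).comp
      (LinearMap.proj i)
    have hφ : ∀ x i, φ x i = g c i ∘ₗ x i := fun x i => rfl
    refine ⟨L.map φ, hLim φ ?_ ?_, ?_⟩
    · intro x y hxy
      funext i
      ext v
      exact wordProd_injective (hA i) c (LinearMap.congr_fun (congrFun hxy i) v)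
    · rintro _ ⟨d, hd, rfl⟩
      refine ⟨d ++ c, by rw [wordAct_append, hd, hc], ?_⟩
      funext i
      rw [hφ, hgapp]
    · beta_reduce
      rw [hZ, ← Submodule.map_comp, ← Submodule.map_comp]
      rfl
  have hret : ∀ W ∈ wordOrbit A Y, ∃ c, wordAct A c W = Y := fun W hW =>
    exists_wordAct_eq hA hfin hW (self_mem_wordOrbit Y)
  choose! c hc using hret
  have hZfin : (subspaceOrbit (A i) Z).Finite := by
    have hinj : ∀ W, Function.Injective fun X : Submodule ℝ (V i) => X.map (g (c W) i) :=
      fun W => Submodule.map_injective_of_injective (wordProd_injective (hA i) (c W))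
    refine (hfin.biUnion fun W _ => (h𝓔.image fun L => L.map (ev i)).preimage
      (hinj W).injOn).subset ?_
    rintro _ ⟨l, rfl⟩
    have hl : wordAct A l Y ∈ wordOrbit A Y := ⟨l, rfl⟩
    simp only [Set.mem_iUnion, Set.mem_preimage]
    refine ⟨_, hl, ?_⟩
    have := hstab (l ++ c (wordAct A l Y)) (by rw [wordAct_append, hc _ hl])
    rw [hgapp, Submodule.map_comp] at this
    exact this
  exact absurd (hmin i Z hZ0 hZfin) (not_le.2 hlt)

end TupleOrbit

section RestrNorm
variable {V : Type*} [NormedAddCommGroup V] [InnerProductSpace ℝ V]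

lemma restrNorm_nonneg (f : V →L[ℝ] V) (U : Submodule ℝ V) : 0 ≤ restrNorm f U :=
  norm_nonneg (f.comp U.subtypeL)

lemma norm_apply_le_restrNorm (f : V →L[ℝ] V) {U : Submodule ℝ V} {x : V} (hx : x ∈ U) :
    ‖f x‖ ≤ restrNorm f U * ‖x‖ :=
  (f.comp U.subtypeL).le_opNorm ⟨x, hx⟩

lemma restrNorm_le {f : V →L[ℝ] V} {U : Submodule ℝ V} {C : ℝ} (hC : 0 ≤ C)
    (h : ∀ x ∈ U, ‖f x‖ ≤ C * ‖x‖) : restrNorm f U ≤ C :=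
  ContinuousLinearMap.opNorm_le_bound _ hC fun x => h x x.2

lemma restrNorm_le_norm (f : V →L[ℝ] V) (U : Submodule ℝ V) : restrNorm f U ≤ ‖f‖ :=
  restrNorm_le (norm_nonneg f) fun x _ => f.le_opNorm x

lemma restrNorm_mul_le (f g : V →L[ℝ] V) (U : Submodule ℝ V) :
    restrNorm (f * g) U ≤ restrNorm g U * restrNorm f (U.map g.toLinearMap) := by
  refine restrNorm_le (mul_nonneg (restrNorm_nonneg _ _) (restrNorm_nonneg _ _)) fun x hx => ?_
  calc ‖(f * g) x‖ = ‖f (g x)‖ := rfl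
    _ ≤ restrNorm f (U.map g.toLinearMap) * ‖g x‖ := norm_apply_le_restrNorm f ⟨x, hx, rfl⟩
    _ ≤ restrNorm f (U.map g.toLinearMap) * (restrNorm g U * ‖x‖) :=
        mul_le_mul_of_nonneg_left (norm_apply_le_restrNorm g hx) (restrNorm_nonneg _ _)
    _ = _ := by ring

lemma exists_half_restrNorm_lt {f : V →L[ℝ] V} {U : Submodule ℝ V} (h : 0 < restrNorm f U) :
    ∃ x ∈ U, ‖x‖ < 1 ∧ restrNorm f U / 2 < ‖f x‖ := by
  obtain ⟨x, hx, hfx⟩ := (f.comp U.subtypeL).exists_lt_apply_of_lt_opNorm (half_lt_self h)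
  exact ⟨x, x.2, hx, hfx⟩

lemma exists_dual_vector_restrNorm [FiniteDimensional ℝ V] {f : V →L[ℝ] V} {U : Submodule ℝ V}
    (h : 0 < restrNorm f U) :
    ∃ v ∈ U, ‖v‖ = 1 ∧ ∀ x ∈ U, restrNorm f U / 2 * |inner ℝ x v| ≤ ‖f x‖ := by
  set T := f.comp U.subtypeL with hT
  have hTn : ‖ContinuousLinearMap.adjoint T‖ = restrNorm f U :=
    LinearIsometryEquiv.norm_map _ T
  have hlt : restrNorm f U / 2 < ‖ContinuousLinearMap.adjoint T‖ := by
    rw [hTn]; exact half_lt_self h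
  obtain ⟨z, hz, hTz⟩ := (ContinuousLinearMap.adjoint T).exists_lt_apply_of_lt_opNorm hlt
  set a := ContinuousLinearMap.adjoint T z with ha
  have ha0 : 0 < ‖a‖ := lt_trans (half_pos h) hTz
  refine ⟨‖a‖⁻¹ • (a : V), U.smul_mem _ a.2, ?_, fun x hx => ?_⟩
  · rw [norm_smul, norm_inv, norm_norm, Submodule.coe_norm, inv_mul_cancel₀]
    rw [← Submodule.coe_norm]; exact ha0.ne'
  · have h1 : inner ℝ x (a : V) = inner ℝ (f x) z := by
      have := ContinuousLinearMap.adjoint_inner_right T ⟨x, hx⟩ z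
      rw [Submodule.coe_inner] at this
      exact this
    rw [inner_smul_right, abs_mul, abs_inv, abs_norm, h1]
    calc restrNorm f U / 2 * (‖a‖⁻¹ * |inner ℝ (f x) z|)
        ≤ ‖a‖ * (‖a‖⁻¹ * |inner ℝ (f x) z|) :=
          mul_le_mul_of_nonneg_right hTz.le (by positivity)
      _ = |inner ℝ (f x) z| := by rw [← mul_assoc, mul_inv_cancel₀ ha0.ne', one_mul]
      _ ≤ ‖f x‖ * ‖z‖ := abs_real_inner_le_norm _ _
      _ ≤ ‖f x‖ := mul_le_of_le_one_right (norm_nonneg _) hz.le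

lemma exists_pow_le_restrNorm {N : ℕ} {B : Fin N → V →L[ℝ] V} (hB : ∀ j, IsUnit (B j)) :
    ∃ κ : ℝ, 0 < κ ∧ ∀ (l : Word N) (U : Submodule ℝ V), U ≠ ⊥ →
      κ ^ l.length ≤ restrNorm (wordProd B l) U := by
  choose u hu using hB
  set M : ℝ := 1 + ∑ j, ‖((u j)⁻¹ : (V →L[ℝ] V)ˣ).val‖ with hM
  have hM0 : 0 < M := by positivity
  have hone : ∀ j x, M⁻¹ * ‖x‖ ≤ ‖B j x‖ := by
    intro j x
    rw [inv_mul_le_iff₀ hM0]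
    have h1 : x = ((u j)⁻¹ : (V →L[ℝ] V)ˣ).val (B j x) := by
      rw [← hu, ← mul_apply_eq_comp, Units.inv_mul, one_apply_eq_self]
    have h2 : ‖((u j)⁻¹ : (V →L[ℝ] V)ˣ).val‖ ≤ M := by
      have := Finset.single_le_sum (f := fun j => ‖((u j)⁻¹ : (V →L[ℝ] V)ˣ).val‖)
        (fun j _ => norm_nonneg _) (Finset.mem_univ j)
      beta_reduce at this
      linarith
    calc ‖x‖ = ‖((u j)⁻¹ : (V →L[ℝ] V)ˣ).val (B j x)‖ := by rw [← h1]
      _ ≤ ‖((u j)⁻¹ : (V →L[ℝ] V)ˣ).val‖ * ‖B j x‖ := ContinuousLinearMap.le_opNorm _ _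
      _ ≤ M * ‖B j x‖ := mul_le_mul_of_nonneg_right h2 (norm_nonneg _)
  have hword : ∀ (l : Word N) x, M⁻¹ ^ l.length * ‖x‖ ≤ ‖wordProd B l x‖ := by
    intro l
    induction l with
    | nil => intro x; simp [wordProd]
    | cons a l ih =>
      intro x
      rw [← List.singleton_append, wordProd_append, wordProd_singleton]
      refine le_trans ?_ (ih (B a x))
      rw [List.length_append, List.length_singleton, add_comm, pow_succ, mul_assoc]
      exact mul_le_mul_of_nonneg_left (hone a x) (by positivity)
  refine ⟨M⁻¹, inv_pos.2 hM0, fun l U hU => ?_⟩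
  obtain ⟨x, hx, hx0⟩ := U.ne_bot_iff.1 hU
  have hxn : 0 < ‖x‖ := norm_pos_iff.2 hx0
  exact le_of_mul_le_mul_right ((hword l x).trans (norm_apply_le_restrNorm _ hx)) hxn

end RestrNorm

section TuplePotential
variable {N : ℕ} {ι : Type*} [Fintype ι] {V : ι → Type*} [∀ i, NormedAddCommGroup (V i)]
  [∀ i, InnerProductSpace ℝ (V i)]

/-- The product of the powers of the norms of the restrictions to a tuple of subspaces. -/
noncomputable def tuplePot (A : ∀ i, Fin N → (V i →L[ℝ] V i)) (β : ι → ℝ)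
    (W : ∀ i, Submodule ℝ (V i)) (l : Word N) : ℝ :=
  ∏ i, restrNorm (wordProd (A i) l) (W i) ^ (β i)

/-- The supremum of the potentials given by a family of tuples of subspaces. -/
noncomputable def familyPot (A : ∀ i, Fin N → (V i →L[ℝ] V i)) (β : ι → ℝ)
    (𝒲 : Set (∀ i, Submodule ℝ (V i))) (l : Word N) : ℝ :=
  sSup ((fun W => tuplePot A β W l) '' 𝒲)

variable {A : ∀ i, Fin N → (V i →L[ℝ] V i)} {β : ι → ℝ} {𝒲 : Set (∀ i, Submodule ℝ (V i))}

lemma tuplePot_nonneg (W : ∀ i, Submodule ℝ (V i)) (l : Word N) : 0 ≤ tuplePot A β W l :=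
  Finset.prod_nonneg fun _ _ => Real.rpow_nonneg (restrNorm_nonneg _ _) _

lemma tuplePot_append_le (hβ : ∀ i, 0 ≤ β i) (W : ∀ i, Submodule ℝ (V i)) (l m : Word N) :
    tuplePot A β W (l ++ m) ≤ tuplePot A β W l * tuplePot A β (wordAct A l W) m := by
  unfold tuplePot
  rw [← Finset.prod_mul_distrib]
  refine Finset.prod_le_prod (fun i _ => Real.rpow_nonneg (restrNorm_nonneg _ _) _) fun i _ => ?_
  rw [← Real.mul_rpow (restrNorm_nonneg _ _) (restrNorm_nonneg _ _), wordProd_append]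
  exact Real.rpow_le_rpow (restrNorm_nonneg _ _) (restrNorm_mul_le _ _ _) (hβ i)

lemma tuplePot_le_prod_norm (hβ : ∀ i, 0 ≤ β i) (W : ∀ i, Submodule ℝ (V i)) (l : Word N) :
    tuplePot A β W l ≤ ∏ i, ‖wordProd (A i) l‖ ^ (β i) :=
  Finset.prod_le_prod (fun _ _ => Real.rpow_nonneg (restrNorm_nonneg _ _) _) fun i _ =>
    Real.rpow_le_rpow (restrNorm_nonneg _ _) (restrNorm_le_norm _ _) (hβ i)

lemma exists_pow_le_tuplePot (hA : ∀ i j, IsUnit (A i j)) (hβ : ∀ i, 0 ≤ β i) :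
    ∃ κ : ℝ, 0 < κ ∧ ∀ (l : Word N) (W : ∀ i, Submodule ℝ (V i)), (∀ i, W i ≠ ⊥) →
      κ ^ l.length ≤ tuplePot A β W l := by
  choose κ hκ H using fun i => exists_pow_le_restrNorm (hA i)
  refine ⟨∏ i, κ i ^ β i, Finset.prod_pos fun i _ => Real.rpow_pos_of_pos (hκ i) _,
    fun l W hW => ?_⟩
  rw [← Finset.prod_pow]
  refine Finset.prod_le_prod (fun i _ => pow_nonneg (Real.rpow_nonneg (hκ i).le _) _)
    fun i _ => ?_
  rw [← Real.rpow_natCast, ← Real.rpow_mul (hκ i).le, mul_comm, Real.rpow_mul (hκ i).le,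
    Real.rpow_natCast]
  exact Real.rpow_le_rpow (pow_pos (hκ i) _).le (H i l (W i) (hW i)) (hβ i)

lemma tuplePot_le_familyPot (hfin : 𝒲.Finite) {W : ∀ i, Submodule ℝ (V i)} (hW : W ∈ 𝒲)
    (l : Word N) : tuplePot A β W l ≤ familyPot A β 𝒲 l :=
  le_csSup (hfin.image _).bddAbove ⟨W, hW, rfl⟩

lemma exists_familyPot_eq (hfin : 𝒲.Finite) (hne : 𝒲.Nonempty) (l : Word N) :
    ∃ W ∈ 𝒲, familyPot A β 𝒲 l = tuplePot A β W l := by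
  obtain ⟨W, hW, h⟩ := (hne.image fun W => tuplePot A β W l).csSup_mem (hfin.image _)
  exact ⟨W, hW, h.symm⟩

lemma familyPot_le_prod_norm (hβ : ∀ i, 0 ≤ β i) (hfin : 𝒲.Finite) (hne : 𝒲.Nonempty)
    (l : Word N) : familyPot A β 𝒲 l ≤ ∏ i, ‖wordProd (A i) l‖ ^ (β i) := by
  obtain ⟨W, -, h⟩ := exists_familyPot_eq (A := A) (β := β) hfin hne l
  rw [h]
  exact tuplePot_le_prod_norm hβ W l

lemma isPotential_familyPot (hA : ∀ i j, IsUnit (A i j)) (hβ : ∀ i, 0 ≤ β i) (hfin : 𝒲.Finite)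
    (hne : 𝒲.Nonempty) (hinv : ∀ W ∈ 𝒲, ∀ l, wordAct A l W ∈ 𝒲)
    (hbot : ∀ W ∈ 𝒲, ∀ i, W i ≠ ⊥) : IsPotential (familyPot A β 𝒲) where
  submult l m := by
    obtain ⟨W, hW, h⟩ := exists_familyPot_eq (A := A) (β := β) hfin hne (l ++ m)
    rw [h]
    refine (tuplePot_append_le hβ W l m).trans ?_
    exact mul_le_mul (tuplePot_le_familyPot hfin hW l)
      (tuplePot_le_familyPot hfin (hinv W hW l) m) (tuplePot_nonneg _ _)
      ((tuplePot_nonneg W l).trans (tuplePot_le_familyPot hfin hW l))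
  exists_pow_le := by
    obtain ⟨κ, hκ, H⟩ := exists_pow_le_tuplePot hA hβ
    obtain ⟨W, hW⟩ := hne
    exact ⟨κ, hκ, fun l => (H l W (hbot W hW)).trans (tuplePot_le_familyPot hfin hW l)⟩

lemma isPotential_prod_norm (hA : ∀ i j, IsUnit (A i j)) (hβ : ∀ i, 0 ≤ β i)
    [∀ i, Nontrivial (V i)] :
    IsPotential fun l : Word N => ∏ i, ‖wordProd (A i) l‖ ^ (β i) where
  submult l m := by
    beta_reduce
    rw [← Finset.prod_mul_distrib]
    refine Finset.prod_le_prod (fun i _ => by positivity) fun i _ => ?_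
    rw [← Real.mul_rpow (norm_nonneg _) (norm_nonneg _), wordProd_append, mul_comm ‖_‖]
    exact Real.rpow_le_rpow (norm_nonneg _) (norm_mul_le _ _) (hβ i)
  exists_pow_le := by
    obtain ⟨κ, hκ, H⟩ := exists_pow_le_tuplePot hA hβ
    exact ⟨κ, hκ, fun l => (H l (fun _ => ⊤) fun i => top_ne_bot).trans
      (tuplePot_le_prod_norm hβ _ l)⟩

end TuplePotential

section FamilyQuasimult
variable {N : ℕ} {ι : Type*} [Fintype ι] {V : ι → Type*} [∀ i, NormedAddCommGroup (V i)]
  [∀ i, InnerProductSpace ℝ (V i)] [∀ i, FiniteDimensional ℝ (V i)]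
  {A : ∀ i, Fin N → (V i →L[ℝ] V i)} {β : ι → ℝ}

/-- In a finite orbit of tuples of subspaces of minimal dimension, some word carries `Y` to `Y'`
and moves given nonzero vectors of `Y` to vectors not orthogonal to given ones in `Y'`. -/
lemma exists_word_inner_ne_zero (hA : ∀ i j, IsUnit (A i j)) {W Y Y' : ∀ i, Submodule ℝ (V i)}
    (hfin : (wordOrbit A W).Finite)
    (hmin : ∀ i, ∀ Z : Submodule ℝ (V i), Z ≠ ⊥ → (subspaceOrbit (A i) Z).Finite →
      Module.finrank ℝ (W i) ≤ Module.finrank ℝ Z)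
    (hY : Y ∈ wordOrbit A W) (hY' : Y' ∈ wordOrbit A W)
    {u v : ∀ i, V i} (hu : ∀ i, u i ∈ Y i) (hu0 : ∀ i, u i ≠ 0)
    (hv : ∀ i, v i ∈ Y' i) (hv0 : ∀ i, v i ≠ 0) :
    ∃ c, wordAct A c Y = Y' ∧ ∀ i, inner ℝ (wordProd (A i) c (u i)) (v i) ≠ 0 := by
  obtain ⟨c₀, hc₀⟩ := exists_wordAct_eq hA hfin hY hY'
  have hfinY : (wordOrbit A Y).Finite := hfin.subset <| by
    rintro _ ⟨l, rfl⟩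
    exact wordAct_mem_wordOrbit hY l
  have hminY : ∀ i, ∀ Z : Submodule ℝ (V i), Z ≠ ⊥ → (subspaceOrbit (A i) Z).Finite →
      Module.finrank ℝ (Y i) ≤ Module.finrank ℝ Z := by
    intro i Z hZ hZf
    rw [finrank_of_mem_subspaceOrbit (hA i) (mem_subspaceOrbit_of_mem_wordOrbit hY i)]
    exact hmin i Z hZ hZf
  obtain ⟨c, hc, hcu⟩ := exists_stabilizer_word hA hfinY hminY hu hu0
    (w := fun i => (innerₗ (V i) (v i)) ∘ₗ (wordProd (A i) c₀).toLinearMap) (by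
      intro i hle
      have hvi : v i ∈ wordAct A c₀ Y i := by rw [hc₀]; exact hv i
      obtain ⟨y, hy, hyv⟩ := hvi
      have h0 := hle hy
      rw [LinearMap.mem_ker, LinearMap.comp_apply] at h0
      rw [hyv] at h0
      exact hv0 i (inner_self_eq_zero.1 h0))
  refine ⟨c ++ c₀, by rw [wordAct_append, hc, hc₀], fun i h => hcu i ?_⟩
  rw [wordProd_append] at h
  rw [real_inner_comm] at h
  exact h

/-- A uniform version of `exists_word_inner_ne_zero` for a fixed pair of tuples. -/
lemma exists_finset_le_abs_inner (hA : ∀ i j, IsUnit (A i j)) {W Y Y' : ∀ i, Submodule ℝ (V i)}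
    (hfin : (wordOrbit A W).Finite)
    (hmin : ∀ i, ∀ Z : Submodule ℝ (V i), Z ≠ ⊥ → (subspaceOrbit (A i) Z).Finite →
      Module.finrank ℝ (W i) ≤ Module.finrank ℝ Z)
    (hY : Y ∈ wordOrbit A W) (hY' : Y' ∈ wordOrbit A W) :
    ∃ κ : ℝ, 0 < κ ∧ ∃ F : Finset (Word N), ∀ u v : ∀ i, V i,
      (∀ i, u i ∈ Y i) → (∀ i, ‖u i‖ = 1) → (∀ i, v i ∈ Y' i) → (∀ i, ‖v i‖ = 1) →
      ∃ c ∈ F, wordAct A c Y = Y' ∧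
        ∀ i, κ ≤ |inner ℝ (wordProd (A i) c (u i)) (v i)| := by
  classical
  have hcpt : ∀ Z : ∀ i, Submodule ℝ (V i),
      IsCompact (Set.univ.pi fun i => (Z i : Set (V i)) ∩ Metric.sphere 0 1) := fun Z =>
    isCompact_univ_pi fun i =>
      (isCompact_sphere _ _).inter_left (Submodule.closed_of_finiteDimensional _)
  let K := (Set.univ.pi fun i => (Y i : Set (V i)) ∩ Metric.sphere 0 1) ×ˢ
    (Set.univ.pi fun i => (Y' i : Set (V i)) ∩ Metric.sphere 0 1)
  let O : Word N × ℕ → Set ((∀ i, V i) × (∀ i, V i)) := fun q =>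
    {x | wordAct A q.1 Y = Y' ∧
      ∀ i, 1 / ((q.2 : ℝ) + 1) < |inner ℝ (wordProd (A i) q.1 (x.1 i)) (x.2 i)|}
  have hO : ∀ q, IsOpen (O q) := by
    intro q
    refine (isOpen_const).inter ?_
    have : {x : (∀ i, V i) × (∀ i, V i) |
        ∀ i, 1 / ((q.2 : ℝ) + 1) < |inner ℝ (wordProd (A i) q.1 (x.1 i)) (x.2 i)|} =
        ⋂ i, {x | 1 / ((q.2 : ℝ) + 1) < |inner ℝ (wordProd (A i) q.1 (x.1 i)) (x.2 i)|} := by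
      ext x; simp
    change IsOpen {x : (∀ i, V i) × (∀ i, V i) |
        ∀ i, 1 / ((q.2 : ℝ) + 1) < |inner ℝ (wordProd (A i) q.1 (x.1 i)) (x.2 i)|}
    rw [this]
    refine isOpen_iInter_of_finite fun i => isOpen_lt continuous_const ?_
    exact ((((wordProd (A i) q.1).continuous.comp
      ((continuous_apply i).comp continuous_fst)).inner
      ((continuous_apply i).comp continuous_snd))).abs
  have hcov : K ⊆ ⋃ q, O q := by
    rintro ⟨u, v⟩ ⟨hu, hv⟩
    simp only [Set.mem_univ_pi, Set.mem_inter_iff, SetLike.mem_coe, mem_sphere_zero_iff_norm]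
      at hu hv
    obtain ⟨c, hc, hcu⟩ := exists_word_inner_ne_zero hA hfin hmin hY hY'
      (fun i => (hu i).1) (fun i h => by simpa [h] using (hu i).2)
      (fun i => (hv i).1) (fun i h => by simpa [h] using (hv i).2)
    choose n hn using fun i => exists_nat_one_div_lt (abs_pos.2 (hcu i))
    refine Set.mem_iUnion.2 ⟨(c, Finset.univ.sup n), hc, fun i => lt_of_le_of_lt ?_ (hn i)⟩
    refine one_div_le_one_div_of_le (by positivity) ?_
    have := Finset.le_sup (f := n) (Finset.mem_univ i)
    gcongr
  obtain ⟨t, ht⟩ := ((hcpt Y).prod (hcpt Y')).elim_finite_subcover O hO hcov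
  refine ⟨1 / ((t.sup Prod.snd : ℕ) + 1), by positivity, t.image Prod.fst,
    fun u v hu hu1 hv hv1 => ?_⟩
  have hmem : ((u, v) : (∀ i, V i) × (∀ i, V i)) ∈ K :=
    ⟨fun i _ => ⟨hu i, by simpa using hu1 i⟩, fun i _ => ⟨hv i, by simpa using hv1 i⟩⟩
  obtain ⟨q, hq, hc, hi⟩ := Set.mem_iUnion₂.1 (ht hmem)
  refine ⟨q.1, Finset.mem_image_of_mem _ hq, hc, fun i => le_trans ?_ (hi i).le⟩
  refine one_div_le_one_div_of_le (by positivity) ?_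
  have := Finset.le_sup (f := Prod.snd) hq
  gcongr

lemma quasimult_familyPot (hA : ∀ i j, IsUnit (A i j)) (hβ : ∀ i, 0 ≤ β i)
    {W : ∀ i, Submodule ℝ (V i)} (hfin : (wordOrbit A W).Finite) (hbot : ∀ i, W i ≠ ⊥)
    (hmin : ∀ i, ∀ Z : Submodule ℝ (V i), Z ≠ ⊥ → (subspaceOrbit (A i) Z).Finite →
      Module.finrank ℝ (W i) ≤ Module.finrank ℝ Z) :
    Quasimult (familyPot A β (wordOrbit A W)) := by
  classical
  have hne : (wordOrbit A W).Nonempty := ⟨W, self_mem_wordOrbit W⟩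
  have hpair : ∀ q : wordOrbit A W × wordOrbit A W,
      ∃ κ : ℝ, 0 < κ ∧ ∃ F : Finset (Word N), ∀ u v : ∀ i, V i,
      (∀ i, u i ∈ q.1.1 i) → (∀ i, ‖u i‖ = 1) → (∀ i, v i ∈ q.2.1 i) → (∀ i, ‖v i‖ = 1) →
      ∃ c ∈ F, wordAct A c q.1.1 = q.2.1 ∧
        ∀ i, κ ≤ |inner ℝ (wordProd (A i) c (u i)) (v i)| := fun q =>
    exists_finset_le_abs_inner hA hfin hmin q.1.2 q.2.2
  choose κ hκ F hF using hpair
  have : Fintype (wordOrbit A W) := hfin.fintype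
  have : Nonempty (wordOrbit A W) := hne.to_subtype
  obtain ⟨q₀, hq₀⟩ := Finite.exists_min κ
  set κ₀ := κ q₀ with hκ₀
  have hκ₀pos : 0 < κ₀ := hκ q₀
  have hpos : ∀ Y ∈ wordOrbit A W, ∀ (l : Word N) i, 0 < restrNorm (wordProd (A i) l) (Y i) := by
    intro Y hY l i
    obtain ⟨κ', hκ', h⟩ := exists_pow_le_restrNorm (hA i)
    refine (pow_pos hκ' l.length).trans_le (h l (Y i) fun hb => ?_)
    have h1 := finrank_of_mem_subspaceOrbit (hA i) (mem_subspaceOrbit_of_mem_wordOrbit hY i)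
    rw [hb, finrank_bot] at h1
    exact hbot i (Submodule.finrank_eq_zero.1 h1.symm)
  refine ⟨∏ i, (κ₀ / 4) ^ β i, Finset.prod_pos fun i _ => Real.rpow_pos_of_pos (by positivity) _,
    Finset.univ.biUnion F, fun l m => ?_⟩
  obtain ⟨Y, hY, hYl⟩ := exists_familyPot_eq (A := A) (β := β) hfin hne l
  obtain ⟨Y', hY', hYm⟩ := exists_familyPot_eq (A := A) (β := β) hfin hne m
  choose x hx hx1 hxl using fun i => exists_half_restrNorm_lt (hpos Y hY l i)
  choose v hv hv1 hvm using fun i => exists_dual_vector_restrNorm (hpos Y' hY' m i)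
  set a : ∀ i, V i := fun i => wordProd (A i) l (x i) with ha
  have ha0 : ∀ i, 0 < ‖a i‖ := fun i => lt_trans (half_pos (hpos Y hY l i)) (hxl i)
  have haY : ∀ i, a i ∈ wordAct A l Y i := fun i => ⟨x i, hx i, rfl⟩
  have hlY := wordAct_mem_wordOrbit hY l
  set q : wordOrbit A W × wordOrbit A W := (⟨_, hlY⟩, ⟨Y', hY'⟩) with hq
  obtain ⟨c, hcF, hcY, hcκ⟩ := hF q (fun i => ‖a i‖⁻¹ • a i) v
    (fun i => Submodule.smul_mem _ _ (haY i))
    (fun i => by rw [norm_smul, norm_inv, norm_norm, inv_mul_cancel₀ (ha0 i).ne']) hv hv1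
  refine ⟨c, Finset.mem_biUnion.2 ⟨q, Finset.mem_univ _, hcF⟩, ?_⟩
  refine le_trans ?_ (tuplePot_le_familyPot hfin hY (l ++ c ++ m))
  rw [hYl, hYm]
  unfold tuplePot
  rw [← Finset.prod_mul_distrib, ← Finset.prod_mul_distrib]
  refine Finset.prod_le_prod (fun i _ => mul_nonneg (Real.rpow_nonneg (by positivity) _)
    (mul_nonneg (Real.rpow_nonneg (restrNorm_nonneg _ _) _)
      (Real.rpow_nonneg (restrNorm_nonneg _ _) _))) fun i _ => ?_
  have hl := restrNorm_nonneg (wordProd (A i) l) (Y i)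
  have hm := restrNorm_nonneg (wordProd (A i) m) (Y' i)
  rw [← Real.mul_rpow hl hm, ← Real.mul_rpow (by positivity) (mul_nonneg hl hm)]
  refine Real.rpow_le_rpow (by positivity) ?_ (hβ i)
  have h1 : ‖wordProd (A i) (l ++ c ++ m) (x i)‖ ≤
      restrNorm (wordProd (A i) (l ++ c ++ m)) (Y i) :=
    (norm_apply_le_restrNorm _ (hx i)).trans
      (mul_le_of_le_one_right (restrNorm_nonneg _ _) (hx1 i).le)
  refine le_trans ?_ h1
  have h2 : wordProd (A i) (l ++ c ++ m) (x i) =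
      wordProd (A i) m (wordProd (A i) c (a i)) := by
    rw [wordProd_append, wordProd_append]; rfl
  have hmem : wordProd (A i) c (a i) ∈ Y' i := by
    have : wordProd (A i) c (a i) ∈ wordAct A c (wordAct A l Y) i := ⟨a i, haY i, rfl⟩
    rwa [hcY] at this
  rw [h2]
  refine le_trans ?_ (hvm i _ hmem)
  have h3 : κ₀ * ‖a i‖ ≤ |inner ℝ (wordProd (A i) c (a i)) (v i)| := by
    have h4 := (hq₀ q).trans (hcκ i)
    rw [map_smul, inner_smul_left, abs_mul] at h4
    simp only [map_inv₀, conj_trivial, abs_inv, abs_norm] at h4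
    rwa [inv_mul_eq_div, le_div_iff₀ (ha0 i)] at h4
  have h5 : restrNorm (wordProd (A i) l) (Y i) / 2 ≤ ‖a i‖ := (hxl i).le
  calc κ₀ / 4 * (restrNorm (wordProd (A i) l) (Y i) * restrNorm (wordProd (A i) m) (Y' i))
      = restrNorm (wordProd (A i) m) (Y' i) / 2 *
        (κ₀ * (restrNorm (wordProd (A i) l) (Y i) / 2)) := by ring
    _ ≤ restrNorm (wordProd (A i) m) (Y' i) / 2 * (κ₀ * ‖a i‖) := by gcongr
    _ ≤ _ := by gcongr

end FamilyQuasimult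

section Packing

/-- Restrictions to the members of a finite spanning family of subspaces control the norm. -/
lemma exists_norm_le_mul_restrNorm {V σ : Type*} [NormedAddCommGroup V] [InnerProductSpace ℝ V]
    [FiniteDimensional ℝ V] [Finite σ] [Nonempty σ] {S : σ → Submodule ℝ V}
    (hS : ⨆ s, S s = ⊤) :
    ∃ C : ℝ, 0 < C ∧ ∀ f : V →L[ℝ] V, ∃ s, ‖f‖ ≤ C * restrNorm f (S s) := by
  classical
  have := Fintype.ofFinite σ
  let T : (∀ s, S s) →ₗ[ℝ] V := ∑ s, (S s).subtype ∘ₗ LinearMap.proj s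
  have hT : ∀ y, T y = ∑ s, (y s : V) := fun y => by simp [T]
  have hTr : LinearMap.range T = ⊤ := by
    rw [eq_top_iff, ← hS, iSup_le_iff]
    intro s v hv
    refine ⟨Pi.single s ⟨v, hv⟩, ?_⟩
    rw [hT, Finset.sum_eq_single s]
    · simp
    · intro b _ hb
      simp [Pi.single_eq_of_ne hb]
    · simp
  obtain ⟨R, hR⟩ := T.exists_rightInverse_of_surjective hTr
  let R' : V →L[ℝ] (∀ s, S s) := R.toContinuousLinearMap
  refine ⟨Fintype.card σ * (‖R'‖ + 1), by positivity, fun f => ?_⟩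
  obtain ⟨s₀, hs₀⟩ := Finite.exists_max fun s => restrNorm f (S s)
  refine ⟨s₀, ContinuousLinearMap.opNorm_le_bound _
    (mul_nonneg (by positivity) (restrNorm_nonneg _ _)) fun v => ?_⟩
  have hv : v = ∑ s, (R' v s : V) := by
    have := LinearMap.congr_fun hR v
    rw [LinearMap.comp_apply, hT] at this
    exact this.symm
  calc ‖f v‖ = ‖∑ s, f (R' v s)‖ := by rw [← map_sum, ← hv]
    _ ≤ ∑ s, ‖f (R' v s)‖ := norm_sum_le _ _
    _ ≤ ∑ _s : σ, restrNorm f (S s₀) * ((‖R'‖ + 1) * ‖v‖) := by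
        refine Finset.sum_le_sum fun s _ => (norm_apply_le_restrNorm f (R' v s).2).trans ?_
        refine mul_le_mul (hs₀ s) ?_ (norm_nonneg _) (restrNorm_nonneg _ _)
        calc ‖((R' v s : S s) : V)‖ ≤ ‖R' v‖ := norm_le_pi_norm (R' v) s
          _ ≤ ‖R'‖ * ‖v‖ := R'.le_opNorm v
          _ ≤ _ := by gcongr; linarith
    _ = _ := by
        rw [Finset.sum_const, Finset.card_univ, nsmul_eq_mul]; ring

/-- If the `i`-th space is spanned by the subspaces `S i r` and those with `i = i₀` lie in one
orbit, then the translates of the tuples which involve only the first subspace at `i₀` suffice to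
control the product of the norms. -/
lemma exists_mul_prod_norm_le_tuplePot {N : ℕ} {ι : Type*} [Fintype ι] [DecidableEq ι]
    {V : ι → Type*} [∀ i, NormedAddCommGroup (V i)] [∀ i, InnerProductSpace ℝ (V i)]
    [∀ i, FiniteDimensional ℝ (V i)] {A : ∀ i, Fin N → (V i →L[ℝ] V i)} {β : ι → ℝ}
    (hA : ∀ i j, IsUnit (A i j)) (hβ : ∀ i, 0 ≤ β i) {t : ι → ℕ} (ht : ∀ i, 0 < t i)
    {S : ∀ i, Fin (t i) → Submodule ℝ (V i)} (hS : ∀ i, ⨆ s, S i s = ⊤) (i₀ : ι)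
    (horb : ∀ r, S i₀ r ∈ subspaceOrbit (A i₀) (S i₀ ⟨0, ht i₀⟩)) :
    ∃ τ : ℝ, 0 < τ ∧ ∀ l : Word N, ∃ (s : ∀ i, Fin (t i)) (m : Word N), s i₀ = ⟨0, ht i₀⟩ ∧
      τ * ∏ i, ‖wordProd (A i) l‖ ^ (β i) ≤ tuplePot A β (wordAct A m fun i => S i (s i)) l := by
  have hne : ∀ i, Nonempty (Fin (t i)) := fun i => ⟨⟨0, ht i⟩⟩
  choose m hm using horb
  have hspan : ∀ (r : Fin (t i₀)) i,
      ⨆ s, (S i s).map (wordProd (A i) (m r)).toLinearMap = ⊤ := by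
    intro r i
    rw [← Submodule.map_iSup, hS, Submodule.map_top, LinearMap.range_eq_top]
    exact LinearMap.injective_iff_surjective.1 (wordProd_injective (hA i) _)
  obtain ⟨C₀, hC₀, hf₀⟩ := exists_norm_le_mul_restrNorm (hS i₀)
  choose C hC hf using fun r i => exists_norm_le_mul_restrNorm (hspan r i)
  set D : ι → ℝ := fun i => C₀ + ∑ r, C r i with hD
  have hCD : ∀ r i, C r i ≤ D i := fun r i => by
    have := Finset.single_le_sum (f := fun r => C r i) (fun r _ => (hC r i).le) (Finset.mem_univ r)
    simp only [hD]; linarith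
  have hC₀D : ∀ i, C₀ ≤ D i := fun i => by
    have := Finset.sum_nonneg (f := fun r => C r i) (s := Finset.univ) fun r _ => (hC r i).le
    simp only [hD]; linarith
  have hDpos : ∀ i, 0 < D i := fun i => hC₀.trans_le (hC₀D i)
  refine ⟨∏ i, (D i)⁻¹ ^ β i,
    Finset.prod_pos fun i _ => Real.rpow_pos_of_pos (inv_pos.2 (hDpos i)) _, fun l => ?_⟩
  obtain ⟨r, hr⟩ := hf₀ (wordProd (A i₀) l)
  choose s hs using fun i => hf r i (wordProd (A i) l)
  refine ⟨Function.update s i₀ ⟨0, ht i₀⟩, m r, Function.update_self .., ?_⟩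
  unfold tuplePot
  rw [← Finset.prod_mul_distrib]
  refine Finset.prod_le_prod (fun i _ => mul_nonneg
    (Real.rpow_nonneg (inv_pos.2 (hDpos i)).le _) (Real.rpow_nonneg (norm_nonneg _) _))
    fun i _ => ?_
  rw [← Real.mul_rpow (inv_pos.2 (hDpos i)).le (norm_nonneg _)]
  refine Real.rpow_le_rpow (mul_nonneg (inv_pos.2 (hDpos i)).le (norm_nonneg _)) ?_ (hβ i)
  rw [inv_mul_le_iff₀ (hDpos i)]
  by_cases hi : i = i₀
  · subst hi
    have : wordAct A (m r) (fun j => S j (Function.update s i ⟨0, ht i⟩ j)) i = S i r := by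
      rw [hm r]
      simp [wordAct]
    rw [this]
    exact hr.trans (mul_le_mul_of_nonneg_right (hC₀D i) (restrNorm_nonneg _ _))
  · have : wordAct A (m r) (fun j => S j (Function.update s i₀ ⟨0, ht i₀⟩ j)) i =
        (S i (s i)).map (wordProd (A i) (m r)).toLinearMap := by
      simp [wordAct, Function.update_of_ne hi]
    rw [this]
    exact (hs i).trans (mul_le_mul_of_nonneg_right (hCD r i) (restrNorm_nonneg _ _))

lemma card_pi_fin_eq_div_sup {ι : Type*} [Fintype ι] [DecidableEq ι] {t : ι → ℕ}
    {i₀ : ι} (h0 : 0 < t i₀) (hmax : ∀ i, t i ≤ t i₀) :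
    Fintype.card {s : ∀ i, Fin (t i) // s i₀ = ⟨0, h0⟩} =
      (∏ i, t i) / Finset.univ.sup t := by
  have hsup : Finset.univ.sup t = t i₀ :=
    le_antisymm (Finset.sup_le fun i _ => hmax i) (Finset.le_sup (Finset.mem_univ i₀))
  rw [hsup]
  symm
  apply Nat.div_eq_of_eq_mul_right h0
  have h := Fintype.card_filter_piFinset_eq_of_mem (fun i => (Finset.univ : Finset (Fin (t i)))) i₀
    (Finset.mem_univ (⟨0, h0⟩ : Fin (t i₀)))
  rw [Fintype.piFinset_univ] at h
  rw [Fintype.card_subtype, h, ← Finset.mul_prod_erase _ t (Finset.mem_univ i₀)]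
  simp

end Packing

/-- structure of equilibrium states in the irreducible case. -/
theorem irreducible_case_equilibrium_structure
    {N k : ℕ} (hN : 2 ≤ N) (hk : 1 ≤ k)
    (V : Fin k → Type*) [∀ i, NormedAddCommGroup (V i)] [∀ i, InnerProductSpace ℝ (V i)]
    [∀ i, FiniteDimensional ℝ (V i)]
    (A : ∀ i : Fin k, Fin N → (V i →L[ℝ] V i)) (hA : ∀ i j, IsUnit (A i j))
    (β : Fin k → ℝ) (hβ : ∀ i, 0 < β i)
    (hirr : ∀ i, IrreducibleTuple (fun j => (A i j : V i →ₗ[ℝ] V i)))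
    (ℓ : Fin k → ℕ)
    -- `ℓ i` is the smallest nonzero dimension of a subspace of `V i` with finite orbit
    -- under `(A_1^{(i)},…,A_N^{(i)})`:
    (hℓ : ∀ i, IsLeast {m : ℕ | 0 < m ∧ ∃ U : Submodule ℝ (V i),
        Module.finrank ℝ U = m ∧
        {W : Submodule ℝ (V i) |
          ∃ l : Word N, W = U.map (wordProd (A i) l).toLinearMap}.Finite} (ℓ i)) :
    -- (1) each `t i := d i / ℓ i` is an integer:
    (∀ i, ℓ i ∣ Module.finrank ℝ (V i)) ∧
    -- (2) with `p = (max_i t_i)⁻¹ ∏_i t_i` there are finite invariant families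
    -- `𝒲_1, …, 𝒲_p` of tuples of `ℓ_i`-dimensional subspaces such that the associated
    -- potentials `Ψ j = Φ^{j}` have the stated properties:
    ∃ p : ℕ, p = (∏ i, Module.finrank ℝ (V i) / ℓ i) /
        (Finset.univ.sup fun i => Module.finrank ℝ (V i) / ℓ i) ∧
      ∃ (𝒲 : Fin p → Set (∀ i, Submodule ℝ (V i))) (Ψ : Fin p → Word N → ℝ),
        (∀ j l, Ψ j l = sSup ((fun W : ∀ i, Submodule ℝ (V i) =>
            ∏ i, restrNorm (wordProd (A i) l) (W i) ^ (β i)) '' 𝒲 j)) ∧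
        (∀ j, (𝒲 j).Finite) ∧
        (∀ j, ∀ W ∈ 𝒲 j, ∀ i, Module.finrank ℝ (W i) = ℓ i) ∧
        -- invariance of each `𝒲 j`:
        (∀ j, ∀ W ∈ 𝒲 j, ∀ l : Word N,
          (fun i => (W i).map (wordProd (A i) l).toLinearMap) ∈ 𝒲 j) ∧
        -- each `Ψ j` is submultiplicative and quasimultiplicative with a unique
        -- equilibrium state satisfying a Gibbs inequality:
        (∀ j, Submult (Ψ j) ∧ Quasimult (Ψ j) ∧
          ∃ μ : Measure (ℕ → Fin N), IsEqState (Ψ j) μ ∧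
            (∀ ν, IsEqState (Ψ j) ν → ν = μ) ∧ ∃ C : ℝ, GibbsWith (Ψ j) μ C) ∧
        -- the comparison `τ Φ ≤ max_j Ψ j ≤ Φ`:
        (∃ τ : ℝ, 0 < τ ∧ ∀ l : Word N,
          (∃ j, τ * (∏ i, ‖wordProd (A i) l‖ ^ (β i)) ≤ Ψ j l) ∧
          (∀ j, Ψ j l ≤ ∏ i, ‖wordProd (A i) l‖ ^ (β i))) ∧
        -- every ergodic equilibrium state of `Φ` is an equilibrium state of some `Ψ j`:
        (∀ μ : Measure (ℕ → Fin N),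
          IsEqState (fun l : Word N => ∏ i, ‖wordProd (A i) l‖ ^ (β i)) μ →
          Ergodic (shift N) μ → ∃ j, IsEqState (Ψ j) μ) ∧
        -- in particular there are at most `p` ergodic equilibrium states of `Φ`:
        (∃ S : Set (Measure (ℕ → Fin N)), S.Finite ∧ S.ncard ≤ p ∧
          ∀ μ, IsEqState (fun l : Word N => ∏ i, ‖wordProd (A i) l‖ ^ (β i)) μ →
            Ergodic (shift N) μ → μ ∈ S) ∧
        -- and every equilibrium state of `Φ` is fully supported:
        (∀ μ, IsEqState (fun l : Word N => ∏ i, ‖wordProd (A i) l‖ ^ (β i)) μ →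
          FullySupported μ) := by
  have : NeZero N := ⟨by omega⟩
  have hβ' : ∀ i, 0 ≤ β i := fun i => (hβ i).le
  choose hℓpos U hU hUfin using fun i => (hℓ i).1
  have hUbot : ∀ i, U i ≠ ⊥ := fun i h => by
    have h1 := hU i
    rw [h, finrank_bot] at h1
    exact (hℓpos i).ne h1
  have hmin : ∀ i, ∀ Z : Submodule ℝ (V i), Z ≠ ⊥ → (subspaceOrbit (A i) Z).Finite →
      Module.finrank ℝ (U i) ≤ Module.finrank ℝ Z := fun i Z hZ hZf => by
    rw [hU i]
    exact (hℓ i).2 ⟨Nat.pos_of_ne_zero fun h => hZ (Submodule.finrank_eq_zero.1 h), Z, rfl, hZf⟩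
  choose t S hSU hStop ht using fun i =>
    exists_orbit_decomposition (hA i) (hirr i) (hUbot i) (hUfin i) (hmin i)
  have hdim : ∀ i, t i * ℓ i = Module.finrank ℝ (V i) := fun i => by rw [← ht i, hU i]
  have hdiv : ∀ i, Module.finrank ℝ (V i) / ℓ i = t i := fun i => by
    rw [← hdim i, Nat.mul_div_cancel _ (hℓpos i)]
  have hVpos : ∀ i, 0 < Module.finrank ℝ (V i) := fun i =>
    (hℓpos i).trans_le (by rw [← hU i]; exact Submodule.finrank_le _)
  have htpos : ∀ i, 0 < t i := fun i => Nat.pos_of_ne_zero fun h => by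
    have h1 := hdim i
    rw [h, zero_mul] at h1
    exact (hVpos i).ne h1
  have hnt : ∀ i, Nontrivial (V i) := fun i => Module.finrank_pos_iff.1 (hVpos i)
  refine ⟨fun i => ⟨t i, by rw [← hdim i, mul_comm]⟩, ?_⟩
  have : Nonempty (Fin k) := ⟨⟨0, hk⟩⟩
  obtain ⟨i₀, hi₀⟩ := Finite.exists_max t
  have hcard := card_pi_fin_eq_div_sup (htpos i₀) hi₀
  have e := Fintype.equivFinOfCardEq hcard
  have hSrank : ∀ i s, Module.finrank ℝ (S i s) = ℓ i := fun i s => by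
    rw [finrank_of_mem_subspaceOrbit (hA i) (hSU i s), hU i]
  let T : {s : ∀ i, Fin (t i) // s i₀ = ⟨0, htpos i₀⟩} → ∀ i, Submodule ℝ (V i) :=
    fun s i => S i (s.1 i)
  simp only [hdiv]
  let 𝒲 : Fin ((∏ i, t i) / Finset.univ.sup t) → Set (∀ i, Submodule ℝ (V i)) :=
    fun j => wordOrbit A (T (e.symm j))
  have hrank : ∀ j, ∀ W ∈ 𝒲 j, ∀ i, Module.finrank ℝ (W i) = ℓ i := fun j W hW i => by
    rw [finrank_of_mem_subspaceOrbit (hA i) (mem_subspaceOrbit_of_mem_wordOrbit hW i)]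
    exact hSrank _ _
  have hfin : ∀ j, (𝒲 j).Finite := fun j =>
    finite_wordOrbit fun i => (hUfin i).subset (subspaceOrbit_subset (hSU i _))
  have hne : ∀ j, (𝒲 j).Nonempty := fun j => ⟨_, self_mem_wordOrbit _⟩
  have hbot : ∀ j, ∀ W ∈ 𝒲 j, ∀ i, W i ≠ ⊥ := fun j W hW i h => by
    have h1 := hrank j W hW i
    rw [h, finrank_bot] at h1
    exact (hℓpos i).ne h1
  have hinv : ∀ j, ∀ W ∈ 𝒲 j, ∀ l, wordAct A l W ∈ 𝒲 j := fun j W hW l =>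
    wordAct_mem_wordOrbit hW l
  have hΨ : ∀ j, IsPotential (familyPot A β (𝒲 j)) := fun j =>
    isPotential_familyPot hA hβ' (hfin j) (hne j) (hinv j) (hbot j)
  have hΦ := isPotential_prod_norm hA hβ'
  have hq : ∀ j, Quasimult (familyPot A β (𝒲 j)) := fun j =>
    quasimult_familyPot hA hβ' (hfin j) (hbot j _ (self_mem_wordOrbit _)) fun i Z hZ hZf => by
      rw [hrank j _ (self_mem_wordOrbit _) i, ← hU i]
      exact hmin i Z hZ hZf
  choose μ hμ huniq herg hgibbs using fun j => (hq j).exists_unique_eqState (hΨ j)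
  have hup : ∀ j l, familyPot A β (𝒲 j) l ≤ ∏ i, ‖wordProd (A i) l‖ ^ (β i) := fun j l =>
    familyPot_le_prod_norm hβ' (hfin j) (hne j) l
  obtain ⟨τ, hτ, hτlow⟩ := exists_mul_prod_norm_le_tuplePot hA hβ' htpos hStop i₀ (by
    intro r
    have h0 := hSU i₀ ⟨0, htpos i₀⟩
    obtain ⟨a, ha⟩ := h0
    obtain ⟨b, hb⟩ := hSU i₀ r
    obtain ⟨c, hc⟩ := exists_word_return
      (fun l (W : Submodule ℝ (V i₀)) => W.map (wordProd (A i₀) l).toLinearMap)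
      (map_wordProd_nil (A i₀)) (map_wordProd_append (A i₀))
      (fun l => Submodule.map_injective_of_injective (wordProd_injective (hA i₀) l)) (hUfin i₀) a
    refine ⟨c ++ b, ?_⟩
    rw [hb, map_wordProd_append, ha]
    exact (congrArg _ hc).symm)
  have hlow : ∀ l : Word N, ∃ j, τ * ∏ i, ‖wordProd (A i) l‖ ^ (β i) ≤
      familyPot A β (𝒲 j) l := by
    intro l
    obtain ⟨s, m, hs, h⟩ := hτlow l
    refine ⟨e ⟨s, hs⟩, h.trans (tuplePot_le_familyPot (hfin _) ?_ l)⟩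
    refine wordAct_mem_wordOrbit ?_ m
    simp only [Equiv.symm_apply_apply]
    exact self_mem_wordOrbit _
  have hac : ∀ ν, IsEqState (fun l : Word N => ∏ i, ‖wordProd (A i) l‖ ^ (β i)) ν →
      ν ≪ Measure.sum μ := fun ν hν =>
    IsEqState.absolutelyContinuous_sum hΦ hΨ hgibbs (fun j => (hμ j).1.1) hτ hlow hup hν
  have hprob : ∀ j, IsProbabilityMeasure (μ j) := fun j => (hμ j).1.1
  have hergeq : ∀ ν, IsEqState (fun l : Word N => ∏ i, ‖wordProd (A i) l‖ ^ (β i)) ν →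
      Ergodic (shift N) ν → ∃ j, ν = μ j := fun ν hν hνe => by
    have := hν.1.1
    exact Ergodic.exists_eq_of_absolutelyContinuous_sum herg hνe (hac ν hν)
  refine ⟨_, rfl, 𝒲, fun j => familyPot A β (𝒲 j), fun j l => rfl, hfin, hrank, hinv,
    fun j => ⟨(hΨ j).submult, hq j, μ j, hμ j, huniq j, hgibbs j⟩,
    ⟨τ, hτ, fun l => ⟨hlow l, fun j => hup j l⟩⟩, fun ν hν hνe => ?_,
    ⟨Set.range μ, Set.finite_range μ, ?_, fun ν hν hνe => ?_⟩, fun ν hν => ?_⟩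
  · obtain ⟨j, rfl⟩ := hergeq ν hν hνe
    exact ⟨j, hμ j⟩
  · rw [← Set.image_univ]
    refine (Set.ncard_image_le Set.finite_univ).trans ?_
    rw [Set.ncard_univ, Nat.card_fin]
  · obtain ⟨j, rfl⟩ := hergeq ν hν hνe
    exact ⟨j, rfl⟩
  · refine hν.1.fullySupported_of_absolutelyContinuous_sum herg (fun j => ?_) (hac ν hν)
    obtain ⟨C, hC⟩ := hgibbs j
    exact hC.fullySupported (hΨ j)
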